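/- arXiv:2312.12278 — 3 statements merged into one kernel-verified Lean document; each statement's English description precedes it below -/
import Mathlib

section
/- There exists a constant c > 0 such that for infinitely many n, every proof-labeling scheme for Convergence(2,4) (deciding, for finite-state dynamics on 4 states, whether every configuration converges in at most 2 time-steps) restricted to n-node instances requires certificates of size at least c · n² / log n bits; this holds even when the problem is restricted to instances whose local functions admit a succinct representation, i.e., each f_v is encodable with O(d(v) · log d(v)) bits where d(v) is the degree of v. -/
/-- The closed neighborhood of a vertex. -/
def closedNbhd {V : Type*} (G : SimpleGraph V) (v : V) : Set V :=
  insert v (G.neighborSet v)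

/-- `F` is a finite-state dynamics over `G`: the new state of each node depends only
on the current states of its closed neighborhood (equivalently, local functions
`f_v : Q^{N[v]} → Q` with `F(x)_v = f_v(x|_{N[v]})` exist). -/
def IsFSD {V Q : Type*} (G : SimpleGraph V) (F : (V → Q) → V → Q) : Prop :=
  ∀ (v : V) (x y : V → Q), (∀ w ∈ closedNbhd G v, x w = y w) → F x v = F y v

/-- Every configuration reaches a fixed point after at most `k` time-steps. -/
def ConvergesIn {V Q : Type*} (F : (V → Q) → V → Q) (k : ℕ) : Prop :=
  ∀ x : V → Q, F (F^[k] x) = F^[k] x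

/-- A proof-labeling scheme (verifier) for finite-state dynamics on `n`-node graphs
with state set `Q`.  The one-round verifier at a node outputs accept/reject as a
function of the node's identifier, its incident edges, its local function, its own
certificate and the certificates of its neighbors only; this is enforced by the
`locality` condition. -/
structure PLS (n : ℕ) (Q : Type*) where
  verify : SimpleGraph (Fin n) → ((Fin n → Q) → Fin n → Q) →
      (Fin n → ℕ) → (Fin n → List Bool) → Fin n → Bool
  locality : ∀ G G' F F' ids ids' cert cert' (v : Fin n),
      (∀ w, G.Adj v w ↔ G'.Adj v w) →
      ids v = ids' v →
      (∀ w, G.Adj v w → ids w = ids' w) →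
      (∀ x, F x v = F' x v) →
      cert v = cert' v →
      (∀ w, G.Adj v w → cert w = cert' w) →
      verify G F ids cert v = verify G' F' ids' cert' v

/-- Correctness of a PLS `π` for the language `L` on the instance domain `Dom`,
with certificates of (possibly instance-dependent) size `size` and identifiers
assigned injectively from `[idMax] = {1,…,idMax}`: on yes-instances some certificate
assignment of the prescribed size makes every node accept (completeness), and on
no-instances every certificate assignment of the prescribed size is rejected at some
node (soundness). -/
def PLS.Correct {n : ℕ} {Q : Type*} (π : PLS n Q)
    (Dom L : SimpleGraph (Fin n) → ((Fin n → Q) → Fin n → Q) → Prop)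
    (size : SimpleGraph (Fin n) → ((Fin n → Q) → Fin n → Q) → ℕ)
    (idMax : ℕ) : Prop :=
  ∀ G F, G.Connected → IsFSD G F → Dom G F →
    ∀ ids : Fin n → ℕ, Function.Injective ids → (∀ v, 1 ≤ ids v ∧ ids v ≤ idMax) →
      ((L G F → ∃ cert : Fin n → List Bool,
          (∀ v, (cert v).length ≤ size G F) ∧ ∀ v, π.verify G F ids cert v = true) ∧
       (¬ L G F → ∀ cert : Fin n → List Bool,
          (∀ v, (cert v).length ≤ size G F) → ∃ v, π.verify G F ids cert v = false))

/-- `b_v(p)`: the number of edges of `G` with an endpoint at distance at most `p`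
from `v`. -/
noncomputable def bv {n : ℕ} (G : SimpleGraph (Fin n)) (v : Fin n) (p : ℕ) : ℕ :=
  {e ∈ G.edgeSet | ∃ u, u ∈ e ∧ G.dist v u ≤ p}.ncard

/-!
STATEMENT 1: There exists a constant c > 0 such that for infinitely many n, every
proof-labeling scheme for Convergence(2,4) restricted to n-node instances requires
certificates of size at least c · n² / log n bits; this holds even when the problem
is restricted to instances whose local functions admit a succinct representation,
i.e., each f_v is encodable with O(d(v)·log d(v)) bits.
-/

open Classical in
/-- The list of neighbors of `v` in increasing order (the "ports" of `v`). -/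
noncomputable def nbrsSorted {n : ℕ} (G : SimpleGraph (Fin n)) (v : Fin n) :
    List (Fin n) :=
  (Finset.univ.filter fun w => G.Adj v w).sort (· ≤ ·)

/-- The dynamics `F` admits a succinct representation (w.r.t. the universal decoder
`dec` and the constant `c`): the local function of every node `v` can be encoded by
a bit string of length `O(d(v)·log d(v))` from which `dec` recovers the new state of
`v` out of the current states on the closed neighborhood of `v`. -/
def Succinct {n : ℕ} (c : ℕ) (dec : List Bool → List (Fin 4) → Fin 4)
    (G : SimpleGraph (Fin n)) (F : (Fin n → Fin 4) → Fin n → Fin 4) : Prop :=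
  ∀ v, ∃ code : List Bool,
    code.length ≤
      c * ((G.neighborSet v).ncard + 1) * (Nat.log 2 ((G.neighborSet v).ncard + 1) + 1) ∧
    ∀ x : Fin n → Fin 4, F x v = dec code (x v :: (nbrsSorted G v).map x)

namespace LB

abbrev Idx (k : ℕ) : Type := Fin k → Bool

abbrev VV (k : ℕ) : Type := Bool × (Idx k ⊕ ((Bool × Fin k) ⊕ Unit))

abbrev nn (k : ℕ) : ℕ := Fintype.card (VV k)

lemma nn_eq (k : ℕ) : nn k = 2 * (2 ^ k + (2 * k + 1)) := by
  simp [nn]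

noncomputable def ee (k : ℕ) : VV k ≃ Fin (nn k) := Fintype.equivFin _

def isCut {k : ℕ} (v : VV k) : Prop := ∃ c, v.2 = Sum.inr c

def GV (k : ℕ) : SimpleGraph (VV k) where
  Adj u v := u ≠ v ∧ (u.1 = v.1 ∨ (isCut u ∧ isCut v))
  symm := ⟨by
    rintro u v ⟨h, h'⟩
    exact ⟨h.symm, h'.imp Eq.symm And.symm⟩⟩
  loopless := ⟨fun u h => h.1 rfl⟩

noncomputable def GF (k : ℕ) : SimpleGraph (Fin (nn k)) := (GV k).comap (ee k).symm

/-- The index encoded by the bit nodes. -/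
def rd {k : ℕ} (x : VV k → Fin 4) (σ b : Bool) : Idx k :=
  fun m => decide (x (σ, Sum.inr (Sum.inl (b, m))) = 1)

open Classical in
noncomputable def upd {k : ℕ} (r : Idx k → Bool) (x : VV k → Fin 4) : VV k → Fin 4
  | (σ, Sum.inl i) => if i = rd x σ false ∧ r (rd x σ true) = true then 1 else 0
  | (σ, Sum.inr (Sum.inl c)) => x (σ, Sum.inr (Sum.inl c))
  | (true, Sum.inr (Sum.inr ())) => if ∃ i, x (true, Sum.inl i) = 1 then 1 else 0
  | (false, Sum.inr (Sum.inr ())) =>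
      if (∃ i, x (false, Sum.inl i) = 1) ∧ x (true, Sum.inr (Sum.inr ())) = 1 ∧
        (∀ b, rd x false b = rd x true b) then 1 else x (false, Sum.inr (Sum.inr ()))

lemma upd_local {k : ℕ} (r : Idx k → Bool) (x y : VV k → Fin 4) (v : VV k)
    (h : ∀ w, w = v ∨ (GV k).Adj v w → x w = y w) : upd r x v = upd r y v := by
  have h1 : ∀ w : VV k, w.1 = v.1 → x w = y w := by
    intro w hw
    apply h
    by_cases e : w = v
    · exact Or.inl e
    · exact Or.inr ⟨fun e' => e e'.symm, Or.inl hw.symm⟩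
  have h2 : isCut v → ∀ w : VV k, isCut w → x w = y w := by
    intro hv w hw
    apply h
    by_cases e : w = v
    · exact Or.inl e
    · exact Or.inr ⟨fun e' => e e'.symm, Or.inr ⟨hv, hw⟩⟩
  obtain ⟨σ, i | c | ⟨⟩⟩ := v
  · have : ∀ b, rd x σ b = rd y σ b := by
      intro b; funext m; simp only [rd]; rw [h1 (σ, Sum.inr (Sum.inl (b, m))) rfl]
    simp only [upd, this]
  · simp only [upd]; exact h1 _ rfl
  · have h3 : ∀ c σ', x (σ', Sum.inr c) = y (σ', Sum.inr c) :=
      fun c σ' => h2 ⟨_, rfl⟩ _ ⟨c, rfl⟩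
    have : ∀ σ b, rd x σ b = rd y σ b := by
      intro σ b; funext m; simp only [rd]; rw [h3]
    cases σ
    · have h4 : ∀ i, x (false, Sum.inl i) = y (false, Sum.inl i) := fun i => h1 _ rfl
      simp only [upd, this, h3, h4]
    · have h4 : ∀ i, x (true, Sum.inl i) = y (true, Sum.inl i) := fun i => h1 _ rfl
      simp only [upd, h4]

noncomputable def FV {k : ℕ} (R : VV k → Idx k → Bool) (x : VV k → Fin 4) : VV k → Fin 4 :=
  fun v => upd (R v) x v

noncomputable def updF {k : ℕ} (r : Idx k → Bool) (x : Fin (nn k) → Fin 4) (v : Fin (nn k)) :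
    Fin 4 := upd r (x ∘ ee k) ((ee k).symm v)

noncomputable def FF {k : ℕ} (R : VV k → Idx k → Bool) (x : Fin (nn k) → Fin 4) :
    Fin (nn k) → Fin 4 :=
  fun v => updF (R ((ee k).symm v)) x v

lemma updF_local {k : ℕ} (r : Idx k → Bool) (x y : Fin (nn k) → Fin 4) (v : Fin (nn k))
    (h : ∀ w ∈ closedNbhd (GF k) v, x w = y w) : updF r x v = updF r y v := by
  apply upd_local
  intro w hw
  apply h
  rcases hw with rfl | hw
  · simp [closedNbhd]
  · right
    simpa [GF] using hw

lemma FF_isFSD {k : ℕ} (R : VV k → Idx k → Bool) : IsFSD (GF k) (FF R) :=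
  fun v x y h => updF_local _ x y v h

lemma GV_conn (k : ℕ) : (GV k).Connected := by
  have top : ∀ v : VV k, (GV k).Reachable v (v.1, Sum.inr (Sum.inr ())) := by
    intro v
    by_cases e : v = (v.1, Sum.inr (Sum.inr ()))
    · rw [← e]
    · exact SimpleGraph.Adj.reachable ⟨e, Or.inl rfl⟩
  have tt : ∀ a b : Bool, (GV k).Reachable (a, Sum.inr (Sum.inr ())) (b, Sum.inr (Sum.inr ())) := by
    intro a b
    by_cases e : a = b
    · rw [e]
    · refine SimpleGraph.Adj.reachable ⟨?_, Or.inr ⟨⟨_, rfl⟩, ⟨_, rfl⟩⟩⟩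
      intro h
      exact e (congrArg Prod.fst h)
  have : Nonempty (VV k) := ⟨(true, Sum.inr (Sum.inr ()))⟩
  exact ⟨fun u v => (top u).trans ((tt _ _).trans (top v).symm)⟩

lemma GF_conn (k : ℕ) : (GF k).Connected :=
  (SimpleGraph.Iso.connected_iff (SimpleGraph.Iso.comap (ee k).symm (GV k))).2 (GV_conn k)

lemma conv_iff {k : ℕ} (R : VV k → Idx k → Bool) :
    ConvergesIn (FF R) 2 ↔ ∀ x, FV R (FV R (FV R x)) = FV R (FV R x) := by
  have key : ∀ x : Fin (nn k) → Fin 4, FF R x = FV R (x ∘ ee k) ∘ (ee k).symm := by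
    intro x; rfl
  have c1 : ∀ y : VV k → Fin 4, (y ∘ (ee k).symm) ∘ ee k = y := by
    intro y; funext v; simp
  simp only [ConvergesIn, Function.iterate_succ, Function.iterate_zero, Function.comp_apply, id,
    key, c1]
  constructor
  · intro h x
    have := congrArg (fun y => y ∘ ee k) (h (x ∘ (ee k).symm))
    simpa only [c1] using this
  · intro h x
    rw [h]

def RR {k : ℕ} (H H' : Idx k → Idx k → Bool) : VV k → Idx k → Bool
  | (false, Sum.inl i) => H i
  | (true, Sum.inl i) => fun j => !(H' i j)
  | (_, Sum.inr _) => fun _ => false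

section dyn
variable {k : ℕ} (H H' : Idx k → Idx k → Bool) (x : VV k → Fin 4)

lemma rd_FV (R : VV k → Idx k → Bool) (σ b : Bool) : rd (FV R x) σ b = rd x σ b := by
  funext m
  have : FV R x (σ, Sum.inr (Sum.inl (b, m))) = x (σ, Sum.inr (Sum.inl (b, m))) := by
    simp only [FV, upd]
  simp only [rd]
  rw [this]

lemma FV_idxA (i : Idx k) : FV (RR H H') x (false, Sum.inl i) = 1 ↔
    i = rd x false false ∧ H i (rd x false true) = true := by
  have gen : ∀ (P : Prop) (d : Decidable P), ((@ite _ P d (1 : Fin 4) 0) = 1 ↔ P) := by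
    intro P d
    by_cases h : P <;> simp [h]
  exact gen _ _

lemma FV_idxB (i : Idx k) : FV (RR H H') x (true, Sum.inl i) = 1 ↔
    i = rd x true false ∧ H' i (rd x true true) = false := by
  simp [FV, upd, RR]

lemma FV_top (R : VV k → Idx k → Bool) : FV R x (true, Sum.inr (Sum.inr ())) = 1 ↔
    ∃ i, x (true, Sum.inl i) = 1 := by
  simp [FV, upd]

lemma yes_conv : ∀ x, FV (RR H H) (FV (RR H H) (FV (RR H H) x)) =
    FV (RR H H) (FV (RR H H) x) := by
  intro x
  set R := RR H H with hR
  have hi : ∀ y σ i, FV R (FV R y) (σ, Sum.inl i) = FV R y (σ, Sum.inl i) := by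
    intro y σ i
    show upd _ (FV R y) _ = upd _ y _
    simp only [upd, rd_FV]
  funext v
  obtain ⟨σ, i | c | ⟨⟩⟩ := v
  · exact hi _ _ _
  · simp [FV, upd]
  · cases σ
    · show upd _ _ _ = _
      simp only [upd]
      rw [if_neg]
      rintro ⟨⟨i, h1⟩, h2, h3⟩
      rw [hR, FV_idxA] at h1
      rw [FV_top] at h2
      obtain ⟨i', h2⟩ := h2
      rw [hR, FV_idxB] at h2
      simp only [rd_FV] at h1 h2 h3
      rw [h3, h3] at h1
      rw [← h1.1] at h2
      rw [h2.1, h1.2] at h2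
      exact absurd h2.2 (by simp)
    · show upd _ _ _ = upd _ _ _
      simp only [upd, hi]

lemma no_conv {i j : Idx k} (h : H i j = true) (h' : H' i j = false) :
    ¬ ∀ x, FV (RR H H') (FV (RR H H') (FV (RR H H') x)) =
    FV (RR H H') (FV (RR H H') x) := by
  intro hc
  let x : VV k → Fin 4 := fun v => match v with
    | (_, Sum.inl _) => 0
    | (_, Sum.inr (Sum.inl (b, m))) => if (if b then j m else i m) then 1 else 0
    | (_, Sum.inr (Sum.inr ())) => 0
  have r0 : ∀ σ, rd x σ false = i := by intro σ; funext m; simp [rd, x]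
  have r1 : ∀ σ, rd x σ true = j := by intro σ; funext m; simp [rd, x]
  set R := RR H H' with hR
  have hA : ∀ y, (∀ σ, rd y σ false = i) → (∀ σ, rd y σ true = j) →
      FV R y (false, Sum.inl i) = 1 := by
    intro y h0 h1; rw [hR, FV_idxA, h0, h1]; exact ⟨rfl, h⟩
  have hB : ∀ y, (∀ σ, rd y σ false = i) → (∀ σ, rd y σ true = j) →
      FV R y (true, Sum.inl i) = 1 := by
    intro y h0 h1; rw [hR, FV_idxB, h0, h1]; exact ⟨rfl, h'⟩
  have e1 : FV R x (false, Sum.inr (Sum.inr ())) = 0 := by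
    show upd _ _ _ = _
    simp [upd, x]
  have e2 : FV R (FV R x) (false, Sum.inr (Sum.inr ())) = 0 := by
    show upd _ _ _ = _
    simp only [upd]
    rw [if_neg, e1]
    rintro ⟨-, h2, -⟩
    rw [FV_top] at h2
    simp [x] at h2
  have e3 : FV R (FV R (FV R x)) (false, Sum.inr (Sum.inr ())) = 1 := by
    show upd _ _ _ = _
    simp only [upd]
    rw [if_pos]
    refine ⟨⟨i, hA _ (by simpa [rd_FV] using r0) (by simpa [rd_FV] using r1)⟩, ?_, ?_⟩
    · rw [FV_top]; exact ⟨i, hB _ r0 r1⟩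
    · intro b; cases b <;> simp [rd_FV, r0, r1]
  rw [hc, e2] at e3
  exact absurd e3 (by decide)

end dyn

/-! Encoding. -/

structure PP where
  k : ℕ
  v : Fin (nn k)
  r : Idx k → Bool

noncomputable def enc (p : PP) : List Bool :=
  List.replicate p.k true ++ false :: (List.replicate p.v.val true ++
    false :: (Finset.univ.toList.map p.r))

lemma rep_inj : ∀ (a b : ℕ) (l l' : List Bool),
    List.replicate a true ++ false :: l = List.replicate b true ++ false :: l' → a = b ∧ l = l'
  | 0, 0, l, l', h => by simpa using h
  | 0, b+1, l, l', h => by simp [List.replicate_succ] at h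
  | a+1, 0, l, l', h => by simp [List.replicate_succ] at h
  | a+1, b+1, l, l', h => by
      simp only [List.replicate_succ, List.cons_append, List.cons.injEq, true_and] at h
      have := rep_inj a b l l' h
      exact ⟨by rw [this.1], this.2⟩

lemma enc_inj : Function.Injective enc := by
  rintro ⟨k, v, r⟩ ⟨k', v', r'⟩ h
  obtain ⟨h1, h2⟩ := rep_inj _ _ _ _ h
  dsimp only at h1
  subst h1
  obtain ⟨h3, h4⟩ := rep_inj _ _ _ _ h2
  have h3 : v = v' := Fin.ext h3
  subst h3
  have : r = r' := by
    funext i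
    dsimp only at h4
    rw [List.map_inj_left] at h4
    exact h4 i (by simp)
  rw [this]

open Classical in
noncomputable def loc (p : PP) (L : List (Fin 4)) : Fin 4 :=
  if h : ∃ x : Fin (nn p.k) → Fin 4, x p.v :: (nbrsSorted (GF p.k) p.v).map x = L then
    updF p.r h.choose p.v else 0

open Classical in
noncomputable def decd (code : List Bool) (L : List (Fin 4)) : Fin 4 :=
  if h : ∃ p, enc p = code then loc h.choose L else 0

lemma decd_enc (p : PP) (L : List (Fin 4)) : decd (enc p) L = loc p L := by
  have h : ∃ q, enc q = enc p := ⟨p, rfl⟩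
  rw [decd, dif_pos h, enc_inj h.choose_spec]

lemma loc_eq (p : PP) (x : Fin (nn p.k) → Fin 4) :
    loc p (x p.v :: (nbrsSorted (GF p.k) p.v).map x) = updF p.r x p.v := by
  have h : ∃ y : Fin (nn p.k) → Fin 4, y p.v :: (nbrsSorted (GF p.k) p.v).map y =
    x p.v :: (nbrsSorted (GF p.k) p.v).map x := ⟨x, rfl⟩
  rw [loc, dif_pos h]
  have hs := h.choose_spec
  apply updF_local
  rw [List.cons.injEq, List.map_inj_left] at hs
  intro w hw
  rcases hw with rfl | hw
  · exact hs.1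
  · apply hs.2
    simpa [nbrsSorted] using hw

lemma deg_ge (k : ℕ) (v : Fin (nn k)) :
    2 ^ k + (2 * k + 1) ≤ ((GF k).neighborSet v).ncard + 1 := by
  have h1 : (Set.range fun w => ee k (((ee k).symm v).1, w)) ⊆ insert v ((GF k).neighborSet v) := by
    rintro _ ⟨w, rfl⟩
    by_cases e : ee k (((ee k).symm v).1, w) = v
    · exact Or.inl e
    · refine Or.inr ⟨fun e' => e ?_, Or.inl ?_⟩
      · exact ((ee k).symm.injective e').symm
      · simp
  have h2 := Set.ncard_le_ncard h1 (Set.toFinite _)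
  rw [Set.ncard_range_of_injective] at h2
  · refine le_trans ?_ (h2.trans (Set.ncard_insert_le _ _))
    simp [Nat.card_eq_fintype_card]
  · intro a b h
    simpa using h

lemma succinct {k : ℕ} (R : VV k → Idx k → Bool) : Succinct 4 decd (GF k) (FF R) := by
  intro v
  refine ⟨enc ⟨k, v, R ((ee k).symm v)⟩, ?_, ?_⟩
  · have h1 := deg_ge k v
    have h2 := v.isLt
    have h3 := nn_eq k
    have h4 : (enc ⟨k, v, R ((ee k).symm v)⟩).length = k + (v.val + (2 ^ k + 1) + 1) := by
      simp [enc]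
    rw [h4]
    refine le_trans ?_ (Nat.le_mul_of_pos_right _ (Nat.succ_pos _))
    omega
  · intro x
    rw [decd_enc]
    exact (loc_eq ⟨k, v, R ((ee k).symm v)⟩ x).symm

/-! Main counting bound. -/

lemma counting (k s : ℕ) (π : PLS (nn k) (Fin 4))
    (hπ : π.Correct (fun G F => Succinct 4 decd G F) (fun _ F => ConvergesIn F 2)
            (fun _ _ => s) (nn k * nn k)) :
    2 ^ k * 2 ^ k ≤ 2 * s * (4 * k + 2) := by
  let ids : Fin (nn k) → ℕ := fun v => v.val + 1
  have hid : Function.Injective ids := by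
    intro a b h; apply Fin.ext; simpa [ids] using h
  have hid2 : ∀ v, 1 ≤ ids v ∧ ids v ≤ nn k * nn k := by
    intro v
    have := v.isLt
    refine ⟨by simp [ids], ?_⟩
    have h2 : nn k ≤ nn k * nn k := Nat.le_mul_self _
    simp only [ids]; omega
  have spec := fun R : VV k → Idx k → Bool =>
    hπ (GF k) (FF R) (GF_conn k) (FF_isFSD R) (succinct R) ids hid hid2
  have yes := fun H : Idx k → Idx k → Bool => (spec (RR H H)).1 ((conv_iff _).2 (yes_conv H))
  choose cert hlen hver using yes
  have mix : ∀ H H' : Idx k → Idx k → Bool,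
      (∀ σ c, cert H (ee k (σ, Sum.inr c)) = cert H' (ee k (σ, Sum.inr c))) →
      ∀ i j, H i j = true → H' i j = true := by
    intro H H' hc i j hij
    by_contra hn
    have hn : H' i j = false := by simpa using hn
    have hcut : ∀ w : VV k, isCut w → cert H (ee k w) = cert H' (ee k w) := by
      rintro ⟨σ, w⟩ ⟨c, rfl⟩; exact hc σ c
    let ct : Fin (nn k) → List Bool :=
      fun v => if ((ee k).symm v).1 = false then cert H v else cert H' v
    obtain ⟨v, hv⟩ := (spec (RR H H')).2 (fun h => no_conv H H' hij hn ((conv_iff _).1 h)) ct (by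
      intro v; simp only [ct]; split_ifs
      · exact hlen H v
      · exact hlen H' v)
    have hv' : π.verify (GF k) (FF (RR H H')) ids ct v = true := by
      obtain ⟨u, rfl⟩ := (ee k).surjective v
      by_cases hs : u.1 = false
      · rw [← hver H (ee k u)]
        apply π.locality
        · intro w; rfl
        · rfl
        · intro w _; rfl
        · intro x
          obtain ⟨σ, i | c⟩ := u
          · simp only at hs
            subst hs
            simp [FF, RR]
          · simp [FF, RR]
        · simp [ct, hs]
        · intro w hw
          obtain ⟨w, rfl⟩ := (ee k).surjective w
          simp only [GF, SimpleGraph.comap_adj, Equiv.symm_apply_apply] at hw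
          simp only [ct, Equiv.symm_apply_apply]
          split_ifs with h
          · rfl
          · rcases hw.2 with h2 | h2
            · exact absurd (h2 ▸ hs) h
            · exact (hcut w h2.2).symm
      · rw [← hver H' (ee k u)]
        apply π.locality
        · intro w; rfl
        · rfl
        · intro w _; rfl
        · intro x
          obtain ⟨σ, i | c⟩ := u
          · have hs : σ = true := by simpa using hs
            subst hs
            simp [FF, RR]
          · simp [FF, RR]
        · simp [ct, hs]
        · intro w hw
          obtain ⟨w, rfl⟩ := (ee k).surjective w
          simp only [GF, SimpleGraph.comap_adj, Equiv.symm_apply_apply] at hw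
          simp only [ct, Equiv.symm_apply_apply]
          split_ifs with h
          · rcases hw.2 with h2 | h2
            · exact absurd (h2.trans h) hs
            · exact hcut w h2.2
          · rfl
    rw [hv] at hv'
    exact absurd hv' (by simp)
  let Φ : (Idx k → Idx k → Bool) → (Bool × ((Bool × Fin k) ⊕ Unit)) → Fin s → Option Bool :=
    fun H c t => (cert H (ee k (c.1, Sum.inr c.2)))[t.val]?
  have hΦ : Function.Injective Φ := by
    intro H H' h
    have hc : ∀ σ c, cert H (ee k (σ, Sum.inr c)) = cert H' (ee k (σ, Sum.inr c)) := by
      intro σ c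
      apply List.ext_getElem?
      intro t
      by_cases ht : t < s
      · exact congrFun (congrFun h (σ, c)) ⟨t, ht⟩
      · rw [List.getElem?_eq_none ((hlen H _).trans (not_lt.1 ht)),
          List.getElem?_eq_none ((hlen H' _).trans (not_lt.1 ht))]
    funext i j
    rw [Bool.eq_iff_iff]
    exact ⟨mix H H' hc i j, mix H' H (fun σ c => (hc σ c).symm) i j⟩
  have hcard := Fintype.card_le_of_injective Φ hΦ
  simp only [Fintype.card_fun, Fintype.card_prod, Fintype.card_sum, Fintype.card_bool,
    Fintype.card_fin, Fintype.card_option, Fintype.card_unit] at hcard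
  have h4 : (2 : ℕ) ^ (2 ^ k * 2 ^ k) ≤ 2 ^ (2 * s * (4 * k + 2)) := by
    calc (2 : ℕ) ^ (2 ^ k * 2 ^ k) = (2 ^ 2 ^ k) ^ 2 ^ k := by rw [pow_mul]
      _ ≤ ((2 + 1) ^ s) ^ (2 * (2 * k + 1)) := hcard
      _ ≤ ((2 ^ 2) ^ s) ^ (2 * (2 * k + 1)) := by gcongr; norm_num
      _ = 2 ^ (2 * s * (4 * k + 2)) := by
        rw [← pow_mul, ← pow_mul]; congr 1; ring
  exact (Nat.pow_le_pow_iff_right (by norm_num)).1 h4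

lemma final (k s : ℕ) (hk : 1 ≤ k) (h : 2 ^ k * 2 ^ k ≤ 2 * s * (4 * k + 2)) :
    (1 / 2000 : ℝ) * (nn k : ℝ) ^ 2 / Real.log (nn k) ≤ (s : ℝ) := by
  have hn := nn_eq k
  have hkN : k < 2 ^ k := Nat.lt_two_pow_self
  set N := 2 ^ k with hN
  have n1 : nn k ≤ 8 * N := by omega
  have n2 : N ≤ nn k := by omega
  have hkr : (1 : ℝ) ≤ k := by exact_mod_cast hk
  have hlog : (k : ℝ) * 0.69 ≤ Real.log (nn k) := by
    have h1 : Real.log ((2 : ℝ) ^ k) ≤ Real.log (nn k) := by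
      apply Real.log_le_log (by positivity)
      have : ((N : ℕ) : ℝ) ≤ nn k := by exact_mod_cast n2
      simpa [hN] using this
    rw [Real.log_pow] at h1
    have := Real.log_two_gt_d9
    nlinarith
  have hpos : 0 < Real.log (nn k) := by nlinarith
  rw [div_le_iff₀ hpos]
  have hr : (N : ℝ) * N ≤ 2 * s * (4 * k + 2) := by exact_mod_cast h
  have hr2 : (nn k : ℝ) ≤ 8 * N := by exact_mod_cast n1
  have hs : (0 : ℝ) ≤ s := Nat.cast_nonneg _
  have hsq : (nn k : ℝ) ^ 2 ≤ (8 * N) ^ 2 := by gcongr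
  have h5 : (s : ℝ) * (k * 0.69) ≤ s * Real.log (nn k) := by gcongr
  have h6 : (s : ℝ) ≤ s * k := by nlinarith
  nlinarith

end LB

/-- Every PLS for Convergence(2,4) needs certificates of Ω(n²/log n) bits, even
restricted to succinctly representable local functions (identifiers in [n²]). -/
theorem statement_1 :
    ∃ (c' : ℕ) (dec : List Bool → List (Fin 4) → Fin 4) (c : ℝ), 0 < c ∧
      {n : ℕ | ∀ (s : ℕ) (π : PLS n (Fin 4)),
          π.Correct (fun G F => Succinct c' dec G F) (fun _ F => ConvergesIn F 2)
            (fun _ _ => s) (n * n) →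
          c * (n : ℝ) ^ 2 / Real.log n ≤ (s : ℝ)}.Infinite := by
  refine ⟨4, LB.decd, 1 / 2000, by norm_num, ?_⟩
  apply Set.infinite_of_forall_exists_gt
  intro a
  refine ⟨LB.nn (a + 1), ?_, ?_⟩
  · intro s π hπ
    exact LB.final _ s (by omega) (LB.counting _ s π hπ)
  · have := LB.nn_eq (a + 1)
    have h2 : 0 < 2 ^ (a + 1) := by positivity
    generalize 2 ^ (a + 1) = N at *
    omega
end

section
/- For every integer t ≥ 1, setting k = 6t, every proof-labeling scheme for Convergence(k,3) (deciding, for finite-state dynamics on 3 states, whether every configuration converges in at most k time-steps), even when the problem is restricted to input graphs of maximum degree at most 3, requires certificates of size at least 2^{k/6}/(k/3) = 2^t/(2t) bits. -/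
namespace S4

inductive Node : Type
  | B : Bool → ℕ → List Bool → Node
  | U : Bool → List Bool → Node
  | T : Bool → List Bool → Node
  | Z : Node

open Node

def Valid (d : ℕ) : Node → Prop
  | B _ j w => j < d ∧ w.length ≤ j
  | U _ w => w.length < d
  | T _ w => w.length ≤ d
  | Z => True

def ins : Node → List Node
  | B s j (_ :: w) => [B s j w]
  | B true j [] => [B false j []]
  | B false _ [] => []
  | U s w => [B s w.length w, T s (false :: w)]
  | T s w => [U s w, T s (true :: w)]
  | Z => [T false [], T true []]

def step (d : ℕ) (X : Bool → List Bool → Bool) (y : Node → Fin 3) : Node → Fin 3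
  | B s j (_ :: w) => y (B s j w)
  | B true j [] => y (B false j [])
  | B false j [] => y (B false j [])
  | U s w => if y (B s w.length w) = 0 then y (T s (false :: w)) else 2
  | T s w => if w.length = d then (if X s w then 1 else 0)
      else if y (U s w) = 2 then y (T s (true :: w)) else y (U s w)
  | Z => if y (T false []) = 1 ∧ y (T true []) = 1 then y Z + 1 else y Z

def side : Node → Bool
  | B s _ _ => s
  | U s _ => s
  | T s _ => s
  | Z => false

def cutNode (d : ℕ) : Option (Fin d) × Bool → Node
  | (some j, b) => B b j []
  | (none, true) => T true []
  | (none, false) => Z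

lemma valid_cut (d : ℕ) (c) : Valid d (cutNode d c) := by
  rcases c with ⟨_ | j, _ | _⟩ <;> simp [cutNode, Valid]

lemma finite_valid (d : ℕ) : Finite {v : Node // Valid d v} := by
  have hL : Finite {l : List Bool // l.length ≤ d} := List.finite_length_le Bool d
  let f : (Bool × Fin (d+1) × {l : List Bool // l.length ≤ d}) ⊕
      ((Bool × {l : List Bool // l.length ≤ d}) ⊕
      ((Bool × {l : List Bool // l.length ≤ d}) ⊕ Unit)) → Node := fun a =>
    match a with
    | .inl (s, j, w) => B s j w.1
    | .inr (.inl (s, w)) => U s w.1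
    | .inr (.inr (.inl (s, w))) => T s w.1
    | .inr (.inr (.inr _)) => Z
  refine Set.Finite.subset (Set.finite_range f) ?_
  rintro (⟨s, j, w⟩ | ⟨s, w⟩ | ⟨s, w⟩ | _) hv
  · obtain ⟨h1, h2⟩ := hv
    exact ⟨.inl (s, ⟨j, by omega⟩, ⟨w, by omega⟩), rfl⟩
  · exact ⟨.inr (.inl (s, ⟨w, le_of_lt hv⟩)), rfl⟩
  · exact ⟨.inr (.inr (.inl (s, ⟨w, hv⟩))), rfl⟩
  · exact ⟨.inr (.inr (.inr ())), rfl⟩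

lemma step_congr (d X) (y y' : Node → Fin 3) (v : Node) (h0 : y v = y' v)
    (h : ∀ w ∈ ins v, y w = y' w) : step d X y v = step d X y' v := by
  rcases v with ⟨_ | _, j, _ | ⟨c, w⟩⟩ | ⟨s, w⟩ | ⟨s, w⟩ | _ <;>
    simp_all [step, ins]

lemma step_side (d X X') (y : Node → Fin 3) (v : Node) (h : X (side v) = X' (side v)) :
    step d X y v = step d X' y v := by
  rcases v with ⟨_ | _, j, _ | ⟨c, w⟩⟩ | ⟨s, w⟩ | ⟨s, w⟩ | _ <;>
    simp_all [step, side]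

lemma ins_side (d : ℕ) (a b : Node) (ha : Valid d a) (h : a ∈ ins b) (hs : side a ≠ side b) :
    (∃ c, cutNode d c = a) ∧ (∃ c, cutNode d c = b) := by
  rcases b with ⟨_ | _, j, _ | ⟨c, w⟩⟩ | ⟨s, w⟩ | ⟨s, w⟩ | _ <;> simp [ins] at h
  · subst h; simp [side] at hs
  · subst h
    exact ⟨⟨(some ⟨j, ha.1⟩, false), rfl⟩, ⟨(some ⟨j, ha.1⟩, true), rfl⟩⟩
  · subst h; simp [side] at hs
  · rcases h with rfl | rfl <;> simp [side] at hs
  · rcases h with rfl | rfl <;> simp [side] at hs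
  · rcases h with rfl | rfl
    · simp [side] at hs
    · exact ⟨⟨(none, true), rfl⟩, ⟨(none, false), rfl⟩⟩

def nbrs : Node → List Node
  | B s j [] => if j = 0 then [B (!s) j [], U s []] else
      [B (!s) j [], B s j [false], B s j [true]]
  | B s j (c :: w) => if j = w.length + 1 then [B s j w, U s (c :: w)] else
      [B s j w, B s j (false :: c :: w), B s j (true :: c :: w)]
  | U s w => [B s w.length w, T s (false :: w), T s w]
  | T s [] => [U s [], T s [true], Z]
  | T s (true :: w) => [U s (true :: w), T s (true :: true :: w), T s w]
  | T s (false :: w) => [U s (false :: w), T s (true :: false :: w), U s w]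
  | Z => [T false [], T true []]

lemma nbrs_len (v : Node) : (nbrs v).length ≤ 3 := by
  rcases v with ⟨_ | _, j, _ | ⟨c, w⟩⟩ | ⟨s, w⟩ | ⟨s, _ | ⟨_ | _, w⟩⟩ | _ <;>
    simp [nbrs] <;> split_ifs <;> simp

lemma mem_nbrs_in (d : ℕ) (a b : Node) (h : a ∈ ins b) (ha : Valid d a) (hb : Valid d b) :
    a ∈ nbrs b := by
  rcases b with ⟨_ | _, j, _ | ⟨c, w⟩⟩ | ⟨s, w⟩ | ⟨s, _ | ⟨_ | _, w⟩⟩ | _ <;>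
    simp [ins] at h <;> simp [nbrs] <;> first | (split_ifs <;> simp [h]) | tauto

lemma mem_nbrs_out (d : ℕ) (a b : Node) (h : b ∈ ins a) (ha : Valid d a) (hb : Valid d b) :
    a ∈ nbrs b := by
  rcases a with ⟨_ | _, j, _ | ⟨c, w⟩⟩ | ⟨s, w⟩ | ⟨s, w⟩ | _ <;> simp [ins] at h
  · subst h
    have h1 := ha.2
    rcases w with _ | ⟨c', w⟩ <;> simp at h1 <;> simp only [nbrs] <;> rw [if_neg (by omega)] <;>
      cases c <;> simp
  · subst h
    simp only [nbrs]; split_ifs <;> simp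
  · subst h
    have h1 := ha.2
    rcases w with _ | ⟨c', w⟩ <;> simp at h1 <;> simp only [nbrs] <;> rw [if_neg (by omega)] <;>
      cases c <;> simp
  · rcases h with rfl | rfl
    · rcases w with _ | ⟨c', w⟩ <;> simp [nbrs]
    · simp [nbrs]
  · rcases h with rfl | rfl <;> simp [nbrs]
  · rcases h with rfl | rfl <;> simp [nbrs]

section
variable {d n : ℕ} (e : {v : Node // Valid d v} ≃ Fin n)

def GG : SimpleGraph (Fin n) :=
  SimpleGraph.fromRel (fun a b => (e.symm a).1 ∈ ins (e.symm b).1)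

open Classical in
noncomputable def ext (x : Fin n → Fin 3) (v : Node) : Fin 3 :=
  if h : Valid d v then x (e ⟨v, h⟩) else 0

noncomputable def FF (X : Bool → List Bool → Bool) (x : Fin n → Fin 3) (v : Fin n) : Fin 3 :=
  step d X (ext e x) (e.symm v).1

lemma ext_FF (X) (x : Fin n → Fin 3) (v : Node) (hv : Valid d v) :
    ext e (FF e X x) v = step d X (ext e x) v := by
  simp [ext, FF, hv]

lemma ext_symm (x : Fin n → Fin 3) (v : Fin n) : ext e x (e.symm v).1 = x v := by
  simp [ext, (e.symm v).2]

lemma isFSD (X) : IsFSD (GG e) (FF e X) := by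
  intro v x y h
  apply step_congr
  · rw [ext_symm, ext_symm]; exact h v (Or.inl rfl)
  · intro w hw
    unfold ext
    split_ifs with hv
    · by_cases hvw : v = e ⟨w, hv⟩
      · rw [← hvw]; exact h v (Or.inl rfl)
      · apply h
        right
        simp [GG, SimpleGraph.mem_neighborSet, SimpleGraph.fromRel_adj, hvw, hw]
    · rfl

lemma degree_le (v : Fin n) : ((GG e).neighborSet v).ncard ≤ 3 := by
  classical
  have hsub : (fun a => (e.symm a).1) '' ((GG e).neighborSet v) ⊆
      ((nbrs (e.symm v).1).toFinset : Set Node) := by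
    rintro _ ⟨w, hw, rfl⟩
    simp only [GG, SimpleGraph.mem_neighborSet, SimpleGraph.fromRel_adj] at hw
    simp only [List.coe_toFinset, Set.mem_setOf_eq]
    rcases hw.2 with h | h
    · exact mem_nbrs_out d _ _ h (e.symm w).2 (e.symm v).2
    · exact mem_nbrs_in d _ _ h (e.symm w).2 (e.symm v).2
  have hinj : Function.Injective (fun a => (e.symm a).1) :=
    Subtype.val_injective.comp e.symm.injective
  rw [← Set.ncard_image_of_injective _ hinj]
  refine (Set.ncard_le_ncard hsub (Finset.finite_toSet _)).trans ?_
  rw [Set.ncard_coe_finset]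
  exact (List.toFinset_card_le _).trans (nbrs_len _)

lemma reach_ins (a b : Node) (ha : Valid d a) (hb : Valid d b) (h : a ∈ ins b) :
    (GG e).Reachable (e ⟨a, ha⟩) (e ⟨b, hb⟩) := by
  by_cases hab : a = b
  · subst hab; exact SimpleGraph.Reachable.refl _
  · apply SimpleGraph.Adj.reachable
    simp [GG, SimpleGraph.fromRel_adj, hab, h]

lemma reach_T (s : Bool) (w : List Bool) : ∀ h : Valid d (T s w),
    (GG e).Reachable (e ⟨T s w, h⟩) (e ⟨Z, trivial⟩) := by
  induction w with
  | nil => intro h; apply reach_ins; cases s <;> simp [ins]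
  | cons c w ih =>
    intro h
    have h' : w.length < d := by simpa [Valid] using h
    have h1 : Valid d (T s w) := h'.le
    have h2 : Valid d (U s w) := h'
    refine SimpleGraph.Reachable.trans ?_ (ih h1)
    cases c
    · exact (reach_ins e _ (U s w) h h2 (by simp [ins])).trans
        (reach_ins e _ _ h2 h1 (by simp [ins]))
    · exact reach_ins e _ _ h h1 (by simp [ins])

lemma reach_U (s : Bool) (w : List Bool) (h : Valid d (U s w)) :
    (GG e).Reachable (e ⟨U s w, h⟩) (e ⟨Z, trivial⟩) :=
  (reach_ins e _ (T s w) h (le_of_lt h) (by simp [ins])).trans (reach_T e s w _)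

lemma reach_B (s : Bool) (j m : ℕ) : ∀ (w : List Bool) (_ : m + w.length = j)
    (h : Valid d (B s j w)),
    (GG e).Reachable (e ⟨B s j w, h⟩) (e ⟨Z, trivial⟩) := by
  induction m with
  | zero =>
    intro w hm h
    obtain rfl : w.length = j := by omega
    exact (reach_ins e _ (U s w) h h.1 (by simp [ins])).trans (reach_U e s w _)
  | succ m ih =>
    intro w hm h
    have h' : Valid d (B s j (true :: w)) := ⟨h.1, by simp; omega⟩
    exact (reach_ins e _ _ h h' (by simp [ins])).trans (ih _ (by simp; omega) h')

lemma conn : (GG e).Connected := by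
  have key : ∀ a, (GG e).Reachable a (e ⟨Z, trivial⟩) := by
    intro a
    obtain ⟨⟨v, hv⟩, rfl⟩ := e.surjective a
    rcases v with ⟨s, j, w⟩ | ⟨s, w⟩ | ⟨s, w⟩ | _
    · exact reach_B e s j (j - w.length) w (by have := hv.2; omega) hv
    · exact reach_U e s w hv
    · exact reach_T e s w hv
    · exact SimpleGraph.Reachable.refl _
  have : Nonempty (Fin n) := ⟨e ⟨Z, trivial⟩⟩
  exact ⟨fun a b => (key a).trans (key b).symm⟩

/-- state of node at time `k` -/
noncomputable def st (X : Bool → List Bool → Bool) (x : Fin n → Fin 3) (k : ℕ) (v : Node) : Fin 3 :=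
  ext e ((FF e X)^[k] x) v

lemma st_succ (X) (x : Fin n → Fin 3) (k : ℕ) (v : Node) (hv : Valid d v) :
    st e X x (k+1) v = step d X (st e X x k) v := by
  unfold st
  rw [Function.iterate_succ_apply', ext_FF e X _ v hv]

def sel (β : ℕ → Fin 3) : ℕ → List Bool → List Bool
  | 0, w => w
  | h + 1, w => sel β h ((if β w.length = 0 then false else true) :: w)

lemma sel_len (β) (h : ℕ) : ∀ w, (sel β h w).length = h + w.length := by
  induction h with
  | zero => simp [sel]
  | succ h ih => intro w; simp [sel, ih]; omega

lemma settle_B (X) (x : Fin n → Fin 3) (s : Bool) (j : ℕ) (w : List Bool) :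
    ∀ (_ : Valid d (B s j w)) (k : ℕ), w.length + 1 ≤ k →
      st e X x k (B s j w) = ext e x (B false j []) := by
  induction w with
  | nil =>
    intro hv
    have hv' : Valid d (B false j []) := hv
    have h0 : ∀ k, st e X x k (B false j []) = ext e x (B false j []) := by
      intro k
      induction k with
      | zero => rfl
      | succ k ih => rw [st_succ e X x k _ hv']; exact ih
    intro k hk
    cases s
    · exact h0 k
    · obtain ⟨k, rfl⟩ : ∃ m, k = m + 1 := ⟨k - 1, by simp at hk; omega⟩
      rw [st_succ e X x k _ hv]; exact h0 k
  | cons c w ih =>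
    intro hv k hk
    obtain ⟨k, rfl⟩ : ∃ m, k = m + 1 := ⟨k - 1, by simp at hk; omega⟩
    have hv' : Valid d (B s j w) := ⟨hv.1, by have := hv.2; simp at this; omega⟩
    rw [st_succ e X x k _ hv]
    have := ih hv' k (by simp at hk; omega)
    cases s <;> exact this

def lf (X : Bool → List Bool → Bool) (s : Bool) (w : List Bool) : Fin 3 := if X s w then 1 else 0

lemma settle_U (X) (x : Fin n → Fin 3) (s : Bool) (w : List Bool) (hv : Valid d (U s w)) (r : ℕ)
    (hr : d ≤ r) (c : Fin 3) (hT : ∀ k, r ≤ k → st e X x k (T s (false :: w)) = c)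
    (k : ℕ) (hk : r + 1 ≤ k) :
    st e X x k (U s w) = if ext e x (B false w.length []) = 0 then c else 2 := by
  obtain ⟨k, rfl⟩ : ∃ m, k = m + 1 := ⟨k - 1, by omega⟩
  have hlt : w.length < d := hv
  rw [st_succ e X x k _ hv]
  simp only [step]
  rw [settle_B e X x s w.length w ⟨hv, le_rfl⟩ k (by omega), hT k (by omega)]

lemma settle_T (X) (x : Fin n → Fin 3) (s : Bool) (h : ℕ) : ∀ (w : List Bool),
    h + w.length = d → ∀ k, d + 1 + 2 * h ≤ k →
      st e X x k (T s w) = lf X s (sel (fun j => ext e x (B false j [])) h w) := by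
  induction h with
  | zero =>
    intro w hw k hk
    obtain ⟨k, rfl⟩ : ∃ m, k = m + 1 := ⟨k - 1, by omega⟩
    have hw' : w.length = d := by omega
    rw [st_succ e X x k (T s w) hw'.le]
    simp only [step, if_pos hw']
    rfl
  | succ h ih =>
    intro w hw k hk
    obtain ⟨k, rfl⟩ : ∃ m, k = m + 1 := ⟨k - 1, by omega⟩
    have hlt : w.length < d := by omega
    rw [st_succ e X x k (T s w) hlt.le]
    have h1 := settle_U e X x s w hlt (d + 1 + 2 * h) (by omega) _
      (fun k hk => ih (false :: w) (by simp; omega) k hk) k (by omega)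
    have h2 := ih (true :: w) (by simp; omega) k (by omega)
    simp only [step, if_neg hlt.ne]
    rw [h1, h2]
    simp only [sel]
    by_cases hb : ext e x (B false w.length []) = 0
    · simp only [hb, if_true]
      rw [if_neg]
      unfold lf
      split_ifs <;> decide
    · simp only [hb, if_false, if_true]

lemma settled (X) (x : Fin n → Fin 3) (v : Node) (hv : Valid d v) (hZ : v ≠ Z) (k : ℕ)
    (hk : 3 * d + 1 ≤ k) : st e X x (k + 1) v = st e X x k v := by
  rcases v with ⟨s, j, w⟩ | ⟨s, w⟩ | ⟨s, w⟩ | _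
  · have h1 := hv.1
    have h2 := hv.2
    rw [settle_B e X x s j w hv _ (by omega), settle_B e X x s j w hv _ (by omega)]
  · have hlt : w.length < d := hv
    have := settle_U e X x s w hv (d + 1 + 2 * (d - (w.length + 1))) (by omega) _
      (fun k hk => settle_T e X x s (d - (w.length + 1)) (false :: w) (by simp; omega) k hk)
    rw [this _ (by omega), this _ (by omega)]
  · have hlt : w.length ≤ d := hv
    rw [settle_T e X x s (d - w.length) w (by omega) _ (by omega),
      settle_T e X x s (d - w.length) w (by omega) _ (by omega)]
  · exact absurd rfl hZ

lemma conv_iff (X) (x : Fin n → Fin 3) (k : ℕ) :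
    FF e X ((FF e X)^[k] x) = (FF e X)^[k] x ↔
      ∀ v, Valid d v → st e X x (k + 1) v = st e X x k v := by
  constructor
  · intro h v hv
    unfold st
    rw [Function.iterate_succ_apply', h]
  · intro h
    funext a
    have := h _ (e.symm a).2
    unfold st at this
    rwa [Function.iterate_succ_apply', ext_symm, ext_symm] at this

lemma yes (X) (hX : ∀ l, l.length = d → ¬ (X false l = true ∧ X true l = true)) (k : ℕ)
    (hk : 3 * d + 1 ≤ k) : ConvergesIn (FF e X) k := by
  intro x
  rw [conv_iff]
  intro v hv
  by_cases hZ : v = Z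
  · subst hZ
    rw [st_succ e X x k _ hv]
    simp only [step]
    rw [if_neg]
    rw [settle_T e X x false d [] (by simp) k (by omega),
      settle_T e X x true d [] (by simp) k (by omega)]
    have := hX (sel (fun j => ext e x (B false j [])) d []) (by simp [sel_len])
    intro h
    apply this
    simpa [lf] using h
  · exact settled e X x v hv hZ k hk

lemma sel_suffix (β : ℕ → Fin 3) (l : List Bool)
    (hβ : ∀ p b u, l = p ++ b :: u → β u.length = if b then 1 else 0) (h : ℕ) :
    ∀ (p u : List Bool), p.length = h → l = p ++ u → sel β h u = l := by
  induction h with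
  | zero => intro p u hp hl; simp [sel, hl, List.length_eq_zero_iff.1 hp]
  | succ h ih =>
    intro p u hp hl
    obtain ⟨q, b, rfl⟩ : ∃ q b, p = q ++ [b] := by
      rcases List.eq_nil_or_concat p with rfl | ⟨q, b, rfl⟩
      · simp at hp
      · exact ⟨q, b, by simp⟩
    have hl' : l = q ++ b :: u := by simpa using hl
    simp only [sel]
    have hb : (if β u.length = 0 then false else true) = b := by
      rw [hβ q b u hl']; cases b <;> simp
    rw [hb]
    exact ih q (b :: u) (by simpa using hp) hl'

lemma no (X) (l : List Bool) (hl : l.length = d) (h1 : X false l = true) (h2 : X true l = true)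
    (k : ℕ) (hk : 3 * d + 1 ≤ k) : ¬ ConvergesIn (FF e X) k := by
  intro hc
  let β : ℕ → Fin 3 := fun j => if l.reverse[j]? = some true then 1 else 0
  let x : Fin n → Fin 3 := fun v => match (e.symm v).1 with
    | B _ j _ => β j
    | _ => 0
  have hx : ∀ j, j < d → ext e x (B false j []) = β j := by
    intro j hj
    have : Valid d (B false j []) := ⟨hj, by simp⟩
    simp [ext, this, x]
  have hsel : sel (fun j => ext e x (B false j [])) d [] = l := by
    apply sel_suffix _ l _ d l [] hl (by simp)
    intro p b u hp
    have hlt : u.length < d := by rw [← hl, hp]; simp; omega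
    simp only [hx _ hlt, β]
    subst hp
    simp
  have := (conv_iff e X x k).1 (hc x) Z trivial
  rw [st_succ e X x k Z trivial] at this
  simp only [step] at this
  rw [settle_T e X x false d [] (by simp) k (by omega),
      settle_T e X x true d [] (by simp) k (by omega), hsel] at this
  simp [lf, h1, h2] at this

end

lemma card_lists (s : ℕ) :
    Fintype.card (Σ i : Fin (s+1), List.Vector Bool i) = 2 ^ (s+1) - 1 := by
  rw [Fintype.card_sigma]
  simp only [card_vector, Fintype.card_bool]
  rw [Fin.sum_univ_eq_sum_range (fun i => 2 ^ i), Nat.geomSum_eq le_rfl]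
  simp

lemma count (t s : ℕ) (ht : 1 ≤ t) (h : s * (2 * t) < 2 ^ t) :
    (2 ^ (s+1) - 1) ^ (4 * t) < 2 ^ (2 ^ (2 * t - 1)) := by
  rcases Nat.eq_zero_or_pos s with rfl | hs
  · simp
  · have ht3 : 3 ≤ t := by
      by_contra hlt
      have : t = 1 ∨ t = 2 := by omega
      rcases this with rfl | rfl <;> omega
    have e1 : (s + 1) * (4 * t) ≤ 2 ^ (2 * t - 1) := by
      calc (s + 1) * (4 * t) ≤ (2 * s) * (4 * t) := Nat.mul_le_mul_right _ (by omega)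
        _ = 4 * (s * (2 * t)) := by ring
        _ ≤ 4 * 2 ^ t := Nat.mul_le_mul_left _ h.le
        _ = 2 ^ (t + 2) := by ring
        _ ≤ 2 ^ (2 * t - 1) := Nat.pow_le_pow_right (by norm_num) (by omega)
    calc (2 ^ (s+1) - 1) ^ (4 * t) < (2 ^ (s+1)) ^ (4 * t) :=
          Nat.pow_lt_pow_left (Nat.sub_lt (by positivity) one_pos) (by omega)
      _ = 2 ^ ((s + 1) * (4 * t)) := (pow_mul 2 (s+1) (4*t)).symm
      _ ≤ _ := Nat.pow_le_pow_right (by norm_num) e1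

def raw (d : ℕ) (A : List.Vector Bool d → Bool) (l : List Bool) : Bool :=
  if h : l.length = d then A ⟨l, h⟩ else false

def inp (d : ℕ) (A A' : List.Vector Bool d → Bool) (s : Bool) (l : List Bool) : Bool :=
  if s then !(raw d A' l) else raw d A l

lemma hybrid {d n : ℕ} (e : {v : Node // Valid d v} ≃ Fin n) (k s M : ℕ) (hk : 3 * d + 1 ≤ k)
    (π : PLS n (Fin 3))
    (hπ : π.Correct (fun G _ => ∀ v, (G.neighborSet v).ncard ≤ 3)
        (fun _ F => ConvergesIn F k) (fun _ _ => s) M)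
    (ids : Fin n → ℕ) (hid : Function.Injective ids) (hid2 : ∀ v, 1 ≤ ids v ∧ ids v ≤ M)
    (A A' : List.Vector Bool d → Bool) (c c' : Fin n → List Bool)
    (hc : ∀ v, (c v).length ≤ s) (hc' : ∀ v, (c' v).length ≤ s)
    (hv : ∀ v, π.verify (GG e) (FF e (inp d A A)) ids c v = true)
    (hv' : ∀ v, π.verify (GG e) (FF e (inp d A' A')) ids c' v = true)
    (heq : ∀ i, c (e ⟨cutNode d i, valid_cut d i⟩) = c' (e ⟨cutNode d i, valid_cut d i⟩))
    (i : List.Vector Bool d) (h1 : A i = true) (h2 : A' i = false) : False := by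
  have hcut : ∀ v w, (GG e).Adj v w → side (e.symm v).1 ≠ side (e.symm w).1 → c w = c' w := by
    intro v w hadj hs
    simp only [GG, SimpleGraph.fromRel_adj] at hadj
    have : ∃ i, cutNode d i = (e.symm w).1 := by
      rcases hadj.2 with h | h
      · exact (ins_side d _ _ (e.symm v).2 h hs).2
      · exact (ins_side d _ _ (e.symm w).2 h hs.symm).1
    obtain ⟨i, hi⟩ := this
    have hw : w = e ⟨cutNode d i, valid_cut d i⟩ := by
      rw [← e.symm_apply_eq]; exact Subtype.ext hi.symm
    rw [hw]; exact heq i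
  let c₂ : Fin n → List Bool := fun v => if side (e.symm v).1 = true then c' v else c v
  have hno := (hπ (GG e) (FF e (inp d A A')) (conn e) (isFSD e _) (degree_le e) ids hid hid2).2
    (no e _ i.1 i.2 (by simp [inp, raw, i.2]; exact h1) (by simp [inp, raw, i.2]; exact h2) k hk)
    c₂ (by intro v; simp only [c₂]; split_ifs; exacts [hc' v, hc v])
  obtain ⟨v, hvf⟩ := hno
  cases hsv : side (e.symm v).1
  · have := π.locality (GG e) (GG e) (FF e (inp d A A')) (FF e (inp d A A)) ids ids c₂ c v
      (fun _ => Iff.rfl) rfl (fun _ _ => rfl)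
      (fun x => step_side _ _ _ _ _ (by rw [hsv]; funext l; simp [inp]))
      (by simp [c₂, hsv])
      (by
        intro w hw
        simp only [c₂]
        split_ifs with h
        · exact (hcut v w hw (by rw [hsv, h]; simp)).symm
        · rfl)
    rw [this, hv] at hvf
    simp at hvf
  · have := π.locality (GG e) (GG e) (FF e (inp d A A')) (FF e (inp d A' A')) ids ids c₂ c' v
      (fun _ => Iff.rfl) rfl (fun _ _ => rfl)
      (fun x => step_side _ _ _ _ _ (by rw [hsv]; funext l; simp [inp]))
      (by simp [c₂, hsv])
      (by
        intro w hw
        simp only [c₂]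
        split_ifs with h
        · rfl
        · exact hcut v w hw (by rw [hsv]; exact fun h' => h h'.symm))
    rw [this, hv'] at hvf
    simp at hvf

lemma main (t : ℕ) (ht : 1 ≤ t) :
    ∃ n : ℕ, ∀ (s : ℕ) (π : PLS n (Fin 3)),
      π.Correct (fun G _ => ∀ v, (G.neighborSet v).ncard ≤ 3)
        (fun _ F => ConvergesIn F (6 * t))
        (fun _ _ => s) (n * n) →
      (2 : ℝ) ^ t / (2 * (t : ℝ)) ≤ (s : ℝ) := by
  obtain ⟨d, hd⟩ : ∃ d, d = 2 * t - 1 := ⟨_, rfl⟩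
  have hk : 3 * d + 1 ≤ 6 * t := by omega
  haveI := finite_valid d
  obtain ⟨n, ⟨e⟩⟩ := Finite.exists_equiv_fin {v : Node // Valid d v}
  refine ⟨n, fun s π hπ => ?_⟩
  by_contra hlt
  push Not at hlt
  have hs : s * (2 * t) < 2 ^ t := by
    rw [lt_div_iff₀ (by positivity)] at hlt
    exact_mod_cast hlt
  let ids : Fin n → ℕ := fun v => v.1 + 1
  have hid : Function.Injective ids := by
    intro a b h; simp only [ids] at h; exact Fin.ext (by omega)
  have hid2 : ∀ v, 1 ≤ ids v ∧ ids v ≤ n * n := by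
    intro v
    have := v.2
    refine ⟨by simp [ids], ?_⟩
    simp only [ids]
    nlinarith
  have hyes : ∀ A : List.Vector Bool d → Bool, ∃ cert : Fin n → List Bool,
      (∀ v, (cert v).length ≤ s) ∧
      ∀ v, π.verify (GG e) (FF e (inp d A A)) ids cert v = true := fun A =>
    (hπ (GG e) (FF e (inp d A A)) (conn e) (isFSD e _) (degree_le e) ids hid hid2).1
      (yes e _ (by intro l _; simp [inp]) _ hk)
  choose cert hlen hver using hyes
  let f : (List.Vector Bool d → Bool) →
      (Option (Fin d) × Bool → Σ i : Fin (s+1), List.Vector Bool i) := fun A i =>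
    ⟨⟨(cert A (e ⟨cutNode d i, valid_cut d i⟩)).length, Nat.lt_succ_of_le (hlen A _)⟩,
      ⟨cert A (e ⟨cutNode d i, valid_cut d i⟩), rfl⟩⟩
  have hcard : Fintype.card (Option (Fin d) × Bool → Σ i : Fin (s+1), List.Vector Bool i) <
      Fintype.card (List.Vector Bool d → Bool) := by
    have h4 : (d + 1) * 2 = 4 * t := by omega
    rw [Fintype.card_fun, Fintype.card_fun, card_lists]
    simp only [Fintype.card_prod, Fintype.card_option, Fintype.card_fin, Fintype.card_bool,
      card_vector]
    rw [h4, hd]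
    exact count t s ht hs
  obtain ⟨A, A', hne, hf⟩ := Fintype.exists_ne_map_eq_of_card_lt f hcard
  have heq : ∀ i, cert A (e ⟨cutNode d i, valid_cut d i⟩) =
      cert A' (e ⟨cutNode d i, valid_cut d i⟩) := by
    intro i
    exact congrArg (fun q : Σ i : Fin (s+1), List.Vector Bool i => q.2.1) (congrFun hf i)
  obtain ⟨i, hi⟩ := Function.ne_iff.1 hne
  cases hA : A i <;> cases hA' : A' i
  · exact hi (hA.trans hA'.symm)
  · exact hybrid e _ s _ hk π hπ ids hid hid2 A' A _ _ (hlen A') (hlen A) (hver A') (hver A)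
      (fun i => (heq i).symm) i hA' hA
  · exact hybrid e _ s _ hk π hπ ids hid hid2 A A' _ _ (hlen A) (hlen A') (hver A) (hver A')
      heq i hA hA'
  · exact hi (hA.trans hA'.symm)

end S4

/-!
STATEMENT 4: For every integer t ≥ 1, setting k = 6t, every proof-labeling scheme
for Convergence(k,3), even when the problem is restricted to input graphs of maximum
degree at most 3, requires certificates of size at least 2^{k/6}/(k/3) = 2^t/(2t)
bits.
-/
theorem statement_4 (t : ℕ) (ht : 1 ≤ t) :
    ∃ n : ℕ, ∀ (s : ℕ) (π : PLS n (Fin 3)),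
      π.Correct (fun G _ => ∀ v, (G.neighborSet v).ncard ≤ 3)
        (fun _ F => ConvergesIn F (6 * t))
        (fun _ _ => s) (n * n) →
      (2 : ℝ) ^ t / (2 * (t : ℝ)) ≤ (s : ℝ) := by
  exact S4.main t ht
end

section
/- There exist a function k(n) = Θ(log n) and a constant c > 0 such that for infinitely many n, every proof-labeling scheme for Convergence(k(n),3) (deciding, on n-node graphs, whether a 3-state finite-state dynamics converges in at most k(n) time-steps), even when the problem is restricted to input graphs of maximum degree at most 3, requires certificates of size at least c · n / (log n)² bits. -/
namespace St5

abbrev V (d : ℕ) := Bool × Fin (d+1) × Fin (2^(d+1))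

def R (d : ℕ) (s : Bool) (j h : ℕ) (s' : Bool) (j' h' : ℕ) : Prop :=
  (s = s' ∧ j = j' ∧ h' = h / 2 ∧ h ≠ 0) ∨
  (s = s' ∧ h = h' ∧ 2^d ≤ h ∧ j' = j + 1) ∨
  (s ≠ s' ∧ j = j' ∧ h = 0 ∧ h' = 0)

def Gr (d : ℕ) : SimpleGraph (V d) :=
  SimpleGraph.fromRel (fun u v => R d u.1 u.2.1 u.2.2 v.1 v.2.1 v.2.2)

def enc (b : Bool) : Fin 3 := if b then 1 else 0

def dec (a : Fin 3) : Bool := decide (a = 1)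

theorem dec_enc (b : Bool) : dec (enc b) = b := by cases b <;> rfl

def rd {d : ℕ} (x : V d → Fin 3) (s : Bool) (j h : ℕ) : Bool :=
  if hh : j < d + 1 ∧ h < 2^(d+1) then dec (x (s, ⟨j, hh.1⟩, ⟨h, hh.2⟩)) else false

def step (d : ℕ) (T : ℕ → Bool) (r : Bool → ℕ → ℕ → Bool) (own : Fin 3)
    (s : Bool) (j h : ℕ) : Fin 3 :=
  if j < d then
    if h = 0 then
      if s then enc (r false j 0) else own
    else if h < 2^d then enc (r s j (h/2))
    else enc ((r s j (h/2) == Nat.testBit h j) && (decide (j = 0) || r s (j-1) h))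
  else
    if h = 0 then
      if s then enc (r true j 1 && r false j 0 && !r true j 0) else enc (r false j 1)
    else if h < 2^d then enc (r s j (2*h) || r s j (2*h+1))
    else enc (T h && (decide (j = 0) || r s (j-1) h))

def F (d : ℕ) (T : Bool → ℕ → Bool) (x : V d → Fin 3) (v : V d) : Fin 3 :=
  step d (T v.1) (rd x) (x v) v.1 v.2.1 v.2.2

theorem rd_congr {d : ℕ} {x y : V d → Fin 3} {s : Bool} {j h : ℕ}
    (H : ∀ (hj : j < d+1) (hh : h < 2^(d+1)), x (s, ⟨j,hj⟩, ⟨h,hh⟩) = y (s, ⟨j,hj⟩, ⟨h,hh⟩)) :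
    rd x s j h = rd y s j h := by
  unfold rd
  split_ifs with hh
  · rw [H hh.1 hh.2]
  · rfl

theorem fsd (d : ℕ) (T : Bool → ℕ → Bool) : IsFSD (Gr d) (F d T) := by
  rintro ⟨s, ⟨j, hj⟩, ⟨h, hh⟩⟩ x y H
  have hown := H (s, ⟨j, hj⟩, ⟨h, hh⟩) (Set.mem_insert _ _)
  have key : ∀ s' j' h', (R d s j h s' j' h' ∨ R d s' j' h' s j h ∨ (s' = s ∧ j' = j ∧ h' = h)) →
      rd x s' j' h' = rd y s' j' h' := by
    intro s' j' h' hR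
    apply rd_congr
    intro a b
    apply H
    by_cases e : ((s, ⟨j, hj⟩, ⟨h, hh⟩) : V d) = (s', ⟨j', a⟩, ⟨h', b⟩)
    · rw [← e]; exact Set.mem_insert _ _
    · apply Set.mem_insert_of_mem
      rw [SimpleGraph.mem_neighborSet, Gr, SimpleGraph.fromRel_adj]
      refine ⟨e, ?_⟩
      rcases hR with hR | hR | ⟨rfl, rfl, rfl⟩
      · exact Or.inl hR
      · exact Or.inr hR
      · exact absurd rfl e
  have hp : (2:ℕ)^d ≥ 1 := Nat.one_le_two_pow
  unfold F step
  simp only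
  rw [hown]
  unfold R at key
  split_ifs with h1 h2 h3 h4 h5 h6 h7
  · rw [key false j 0 (by grind)]
  · rfl
  · rw [key s j (h/2) (by grind)]
  · rw [key s j (h/2) (by grind)]
    by_cases j0 : j = 0
    · simp [j0]
    · rw [key s (j-1) h (by grind)]
  · rw [key true j 1 (by grind), key false j 0 (by grind), key true j 0 (by grind)]
  · rw [key false j 1 (by grind)]
  · rw [key s j (2*h) (by grind), key s j (2*h+1) (by grind)]
  · by_cases j0 : j = 0
    · simp [j0]
    · rw [key s (j-1) h (by grind)]

def emb (d : ℕ) (v : V d) : Bool × ℕ × ℕ := (v.1, v.2.1, v.2.2)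

theorem emb_inj (d : ℕ) : Function.Injective (emb d) := by
  rintro ⟨s, ⟨j, hj⟩, ⟨h, hh⟩⟩ ⟨s', ⟨j', hj'⟩, ⟨h', hh'⟩⟩ e
  simp [emb] at e ⊢
  exact e

theorem ncard3 {α : Type*} (a b c : α) : ({a, b, c} : Set α).ncard ≤ 3 := by
  refine (Set.ncard_insert_le _ _).trans ?_
  have := Set.ncard_insert_le b {c}
  simp at this
  omega

theorem deg (d : ℕ) (v : V d) : ((Gr d).neighborSet v).ncard ≤ 3 := by
  rw [← Set.ncard_image_of_injective _ (emb_inj d)]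
  have : ∃ a b c, emb d '' ((Gr d).neighborSet v) ⊆ {a, b, c} := by
    obtain ⟨s, ⟨j, hj⟩, ⟨h, hh⟩⟩ := v
    have hp : (2:ℕ)^d ≥ 1 := Nat.one_le_two_pow
    by_cases h0 : h = 0
    · refine ⟨(!s, j, 0), (s, j, 1), (s,j,1), ?_⟩
      rintro _ ⟨⟨s', ⟨j', hj'⟩, ⟨h', hh'⟩⟩, hw, rfl⟩
      rw [SimpleGraph.mem_neighborSet, Gr, SimpleGraph.fromRel_adj] at hw
      simp only [R] at hw
      simp only [emb, Set.mem_insert_iff, Set.mem_singleton_iff, Prod.mk.injEq]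
      rcases hw.2 with (hw | hw | hw) | (hw | hw | hw)
      · omega
      · omega
      · left; refine ⟨?_, by omega, by omega⟩
        have := hw.1; revert this; cases s <;> cases s' <;> simp
      · right; left; refine ⟨hw.1, by omega, by omega⟩
      · omega
      · left; refine ⟨?_, by omega, by omega⟩
        have := hw.1; revert this; cases s <;> cases s' <;> simp
    · by_cases h1 : h < 2^d
      · refine ⟨(s, j, h/2), (s, j, 2*h), (s,j,2*h+1), ?_⟩
        rintro _ ⟨⟨s', ⟨j', hj'⟩, ⟨h', hh'⟩⟩, hw, rfl⟩
        rw [SimpleGraph.mem_neighborSet, Gr, SimpleGraph.fromRel_adj] at hw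
        simp only [R] at hw
        simp only [emb, Set.mem_insert_iff, Set.mem_singleton_iff, Prod.mk.injEq]
        rcases hw.2 with (hw | hw | hw) | (hw | hw | hw)
        · left; exact ⟨hw.1.symm, by omega, by omega⟩
        · omega
        · omega
        · right
          have : h' = 2*h ∨ h' = 2*h+1 := by omega
          rcases this with e | e
          · left; exact ⟨hw.1, by omega, e⟩
          · right; exact ⟨hw.1, by omega, e⟩
        · omega
        · omega
      · refine ⟨(s, j, h/2), (s, j+1, h), (s,j-1,h), ?_⟩
        rintro _ ⟨⟨s', ⟨j', hj'⟩, ⟨h', hh'⟩⟩, hw, rfl⟩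
        rw [SimpleGraph.mem_neighborSet, Gr, SimpleGraph.fromRel_adj] at hw
        simp only [R] at hw
        simp only [emb, Set.mem_insert_iff, Set.mem_singleton_iff, Prod.mk.injEq]
        rw [pow_succ] at hh'
        rcases hw.2 with (hw | hw | hw) | (hw | hw | hw)
        · left; exact ⟨hw.1.symm, by omega, by omega⟩
        · right; left; exact ⟨hw.1.symm, by omega, by omega⟩
        · omega
        · omega
        · right; right; exact ⟨hw.1, by omega, by omega⟩
        · omega
  obtain ⟨a, b, c, habc⟩ := this
  exact (Set.ncard_le_ncard habc (Set.toFinite _)).trans (ncard3 a b c)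

theorem reach_of_R {d : ℕ} {s : Bool} {j h : ℕ} {s' : Bool} {j' h' : ℕ}
    {hj : j < d+1} {hh : h < 2^(d+1)} {hj' : j' < d+1} {hh' : h' < 2^(d+1)}
    (hR : R d s j h s' j' h') :
    (Gr d).Reachable (s, ⟨j,hj⟩, ⟨h,hh⟩) (s', ⟨j',hj'⟩, ⟨h',hh'⟩) := by
  by_cases e : ((s, ⟨j, hj⟩, ⟨h, hh⟩) : V d) = (s', ⟨j', hj'⟩, ⟨h', hh'⟩)
  · rw [e]
  · apply SimpleGraph.Adj.reachable
    rw [Gr, SimpleGraph.fromRel_adj]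
    exact ⟨e, Or.inl hR⟩

theorem reach_root {d : ℕ} (s : Bool) (j : ℕ) (hj : j < d+1) (h : ℕ) : ∀ (hh : h < 2^(d+1)),
    (Gr d).Reachable (s, ⟨j,hj⟩, ⟨h,hh⟩) (s, ⟨j,hj⟩, ⟨0, by positivity⟩) := by
  induction h using Nat.strong_induction_on with
  | _ h ih =>
    intro hh
    by_cases h0 : h = 0
    · subst h0; rfl
    · refine (reach_of_R (hh' := by omega) (hj' := hj) (h' := h/2) (s' := s) ?_).trans (ih (h/2) (by omega) (by omega))
      left; exact ⟨rfl, rfl, rfl, h0⟩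

theorem reach_chain {d : ℕ} (s : Bool) (j : ℕ) : ∀ (hj : j < d+1),
    (Gr d).Reachable (s, ⟨j,hj⟩, ⟨0, by positivity⟩) (s, ⟨0,by omega⟩, ⟨0, by positivity⟩) := by
  induction j with
  | zero => intro hj; rfl
  | succ j ih =>
    intro hj
    have hl : 2^d < 2^(d+1) := by rw [pow_succ]; have : (2:ℕ)^d ≥ 1 := Nat.one_le_two_pow
                                  omega
    refine (reach_root s (j+1) hj (2^d) hl).symm.trans ?_
    refine SimpleGraph.Reachable.trans ?_ (ih (by omega))
    refine SimpleGraph.Reachable.trans ?_ (reach_root s j (by omega) (2^d) hl)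
    refine (reach_of_R ?_).symm
    right; left; exact ⟨rfl, rfl, le_rfl, rfl⟩

theorem conn (d : ℕ) : (Gr d).Connected := by
  have key : ∀ v : V d, (Gr d).Reachable v (false, ⟨0,by omega⟩, ⟨0, by positivity⟩) := by
    rintro ⟨s, ⟨j, hj⟩, ⟨h, hh⟩⟩
    refine (reach_root s j hj h hh).trans ((reach_chain s j hj).trans ?_)
    cases s
    · rfl
    · apply reach_of_R
      right; right; simp
  have : Nonempty (V d) := ⟨(false, ⟨0,by omega⟩, ⟨0, by positivity⟩)⟩
  exact SimpleGraph.Connected.mk (fun u v => (key u).trans (key v).symm)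

/-! Convergence -/

def IsOut (d : ℕ) (v : V d) : Prop := v.1 = true ∧ (v.2.1 : ℕ) = d ∧ (v.2.2 : ℕ) = 0

def rank (d : ℕ) (s : Bool) (j h : ℕ) : ℕ :=
  if j < d then
    if h = 0 then (if s then 1 else 0)
    else if h < 2^d then 2 + Nat.log 2 h
    else 2 + d + j
  else if h = 0 then 3 + 3*d
  else 2 + 2*d + (d - Nat.log 2 h)

theorem rank_le (d : ℕ) (s : Bool) (j h : ℕ) : rank d s j h ≤ 3 * d + 3 := by
  unfold rank
  split_ifs with h1 h2 h3 h4
  · omega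
  · omega
  · have : Nat.log 2 h < d := Nat.log_lt_of_lt_pow h2 h4
    omega
  all_goals omega

theorem log_half {h : ℕ} (h2 : 2 ≤ h) : Nat.log 2 h = Nat.log 2 (h/2) + 1 := by
  have := Nat.log_div_base 2 h
  have h3 : 0 < Nat.log 2 h := Nat.log_pos (by norm_num) h2
  omega

theorem log_leaf {d h : ℕ} (h1 : 2^d ≤ h) (h2 : h < 2^(d+1)) : Nat.log 2 h = d :=
  (Nat.log_eq_iff (by right; exact ⟨by norm_num, by have : (2:ℕ)^d ≥ 1 := Nat.one_le_two_pow
                                                    omega⟩)).2 ⟨h1, h2⟩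

theorem F_dep (d : ℕ) (T : Bool → ℕ → Bool) (v : V d) (hv : ¬ IsOut d v) :
    (∀ x, F d T x v = x v) ∨ (0 < rank d v.1 v.2.1 v.2.2 ∧ ∀ y z : V d → Fin 3,
      (∀ w : V d, ¬ IsOut d w → rank d w.1 w.2.1 w.2.2 < rank d v.1 v.2.1 v.2.2 → y w = z w) →
      F d T y v = F d T z v) := by
  obtain ⟨s, ⟨j, hj⟩, ⟨h, hh⟩⟩ := v
  simp only [IsOut, F, step] at hv ⊢
  have hp : (2:ℕ)^d ≥ 1 := Nat.one_le_two_pow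
  by_cases c0 : j < d ∧ h = 0 ∧ s = false
  · left; intro x; simp [c0]
  right
  refine ⟨?_, ?_⟩
  · unfold rank; grind
  intro y z H
  have key : ∀ s' j' h', ¬ (s' = true ∧ j' = d ∧ h' = 0) →
      (j' < d+1 → h' < 2^(d+1) → rank d s' j' h' < rank d s j h) → rd y s' j' h' = rd z s' j' h' := by
    intro s' j' h' h1 h2
    apply rd_congr
    intro a b
    apply H
    · simpa [IsOut] using h1
    · exact h2 a b
  unfold rank at key
  split_ifs with h1 h2 h3 h4 h5 h6 h7
  · rw [key false j 0 (by grind) (by grind)]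
  · grind
  · rw [key s j (h/2) (by grind) ?_]
    intro _ _
    by_cases hh1 : h = 1
    · subst hh1; simp [h1, h4]; cases s <;> simp
    · have := log_half (h := h) (by omega)
      have a1 : h/2 ≠ 0 := by omega
      have a2 : h/2 < 2^d := by omega
      simp [h1, h2, h4, a1, a2]; omega
  · have e1 := pow_succ 2 d
    have k1 : rd y s j (h/2) = rd z s j (h/2) := by
      apply key _ _ _ (by grind)
      intro _ _
      have a0 : (2:ℕ)^d ≥ 2 := by
        calc (2:ℕ) = 2^1 := rfl
          _ ≤ 2^d := Nat.pow_le_pow_right (by norm_num) (by omega)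
      have a1 : h/2 ≠ 0 := by omega
      have a2 : h/2 < 2^d := by omega
      have := log_half (h := h) (by omega)
      have := log_leaf (d := d) (h := h) (by omega) hh
      simp only [h1, h2, h4, a1, a2, if_true, if_false]; omega
    rw [k1]
    by_cases j0 : j = 0
    · simp [j0]
    · rw [key s (j-1) h (by grind) ?_]
      intro _ _
      have : j - 1 < d := by omega
      simp only [h1, h2, h4, this, if_true, if_false]; omega
  · grind
  · rw [key false j 1 (by grind) ?_]
    intro _ _
    have h2 : h = 0 := by assumption
    simp [h1, h2]; omega
  · have h2 : ¬ h = 0 := by assumption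
    have c1 := log_half (h := 2*h) (by omega)
    have c2 := log_half (h := 2*h+1) (by omega)
    have b1 : 2 * h / 2 = h := by omega
    have b2 : (2 * h + 1) / 2 = h := by omega
    rw [b1] at c1
    rw [b2] at c2
    have : Nat.log 2 h < d := Nat.log_lt_of_lt_pow h2 (by assumption)
    rw [key s j (2*h) (by grind) ?_, key s j (2*h+1) (by grind) ?_]
    · intro _ _
      have g1 : 2 * h + 1 ≠ 0 := by omega
      have g2 : 2 * h ≠ 0 := by omega
      simp only [h1, h2, g1, g2, if_false]; omega
    · intro _ _
      have g1 : 2 * h + 1 ≠ 0 := by omega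
      have g2 : 2 * h ≠ 0 := by omega
      simp only [h1, h2, g1, g2, if_false]; omega
  · by_cases j0 : j = 0
    · simp [j0]
    · rw [key s (j-1) h (by grind) ?_]
      intro _ _
      have : j - 1 < d := by omega
      have h8 : ¬ h < 2^d := by assumption
      have h2 : ¬ h = 0 := by assumption
      have h9 := log_leaf (d := d) (h := h) (by omega) hh
      simp only [h1, h2, h8, this, if_true, if_false]; omega

theorem settle (d : ℕ) (T : Bool → ℕ → Bool) (x : V d → Fin 3) (t : ℕ) :
    ∀ v : V d, ¬ IsOut d v → rank d v.1 v.2.1 v.2.2 ≤ t →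
      F d T ((F d T)^[t] x) v = (F d T)^[t] x v := by
  induction t with
  | zero =>
    intro v hv hr
    rcases F_dep d T v hv with h | ⟨h, _⟩
    · exact h _
    · omega
  | succ t ih =>
    intro v hv hr
    rcases F_dep d T v hv with h | ⟨_, h⟩
    · exact h _
    · rw [Function.iterate_succ_apply']
      apply h
      intro w hw hwr
      exact ih w hw (by omega)

/-- all but the output node are stable -/
def Semi (d : ℕ) (T : Bool → ℕ → Bool) (y : V d → Fin 3) : Prop :=
  ∀ v : V d, ¬ IsOut d v → F d T y v = y v

theorem semi_rd {d : ℕ} {T : Bool → ℕ → Bool} {y : V d → Fin 3} (hy : Semi d T y)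
    (s : Bool) (j h : ℕ) (hj : j < d+1) (hh : h < 2^(d+1)) (ho : ¬ (s = true ∧ j = d ∧ h = 0)) :
    rd y s j h = dec (step d (T s) (rd y) (y (s,⟨j,hj⟩,⟨h,hh⟩)) s j h) := by
  have := hy (s,⟨j,hj⟩,⟨h,hh⟩) (by simpa [IsOut] using ho)
  conv_lhs => unfold rd
  rw [dif_pos ⟨hj, hh⟩]
  exact congrArg dec this.symm

theorem semi_root {d : ℕ} {T : Bool → ℕ → Bool} {y : V d → Fin 3} (hy : Semi d T y)
    (s : Bool) (j : ℕ) (hj : j < d) : rd y s j 0 = rd y false j 0 := by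
  cases s
  · rfl
  · rw [semi_rd hy true j 0 (by omega) (by positivity) (by omega)]
    simp [step, hj, dec_enc]

theorem semi_down {d : ℕ} {T : Bool → ℕ → Bool} {y : V d → Fin 3} (hy : Semi d T y)
    (s : Bool) (j : ℕ) (hj : j < d) (h : ℕ) : h < 2^d → rd y s j h = rd y false j 0 := by
  induction h using Nat.strong_induction_on with
  | _ h ih =>
    intro hh
    by_cases h0 : h = 0
    · subst h0; exact semi_root hy s j hj
    · rw [semi_rd hy s j h (by omega) (by rw [pow_succ]; omega) (by omega)]
      simp only [step, hj, h0, hh, if_true, if_false, dec_enc]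
      exact ih _ (by omega) (by omega)

theorem semi_leaf {d : ℕ} {T : Bool → ℕ → Bool} {y : V d → Fin 3} (hy : Semi d T y)
    (s : Bool) (h : ℕ) (h1 : 2^d ≤ h) (h2 : h < 2^(d+1)) (j : ℕ) : j < d →
    (rd y s j h = true ↔ ∀ i ≤ j, rd y false i 0 = h.testBit i) := by
  have hp : (2:ℕ)^d ≥ 1 := Nat.one_le_two_pow
  have h0 : h ≠ 0 := by omega
  have h3 : ¬ h < 2^d := by omega
  have h4 : h/2 < 2^d := by rw [pow_succ] at h2; omega
  induction j with
  | zero =>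
    intro hj
    rw [semi_rd hy s 0 h (by omega) h2 (by omega)]
    simp only [step, hj, h0, h3, if_true, if_false, dec_enc]
    rw [semi_down hy s 0 hj _ h4]
    simp
  | succ j ih =>
    intro hj
    rw [semi_rd hy s (j+1) h (by omega) h2 (by omega)]
    simp only [step, hj, h0, h3, if_true, if_false, dec_enc]
    rw [semi_down hy s (j+1) hj _ h4]
    have := ih (by omega)
    simp only [Nat.add_sub_cancel, Bool.and_eq_true, beq_iff_eq, Bool.or_eq_true, decide_eq_true_eq, this]
    constructor
    · rintro ⟨a, b⟩ i hi
      rcases Nat.lt_or_ge i (j+1) with c | c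
      · rcases b with b | b
        · omega
        · exact b i (by omega)
      · have : i = j+1 := by omega
        subst this; exact a
    · intro a
      exact ⟨a _ le_rfl, Or.inr fun i hi => a i (by omega)⟩

theorem semi_top {d : ℕ} {T : Bool → ℕ → Bool} {y : V d → Fin 3} (hy : Semi d T y)
    (s : Bool) (h : ℕ) (h1 : 2^d ≤ h) (h2 : h < 2^(d+1)) :
    (rd y s d h = true ↔ T s h = true ∧ ∀ i < d, rd y false i 0 = h.testBit i) := by
  have hp : (2:ℕ)^d ≥ 1 := Nat.one_le_two_pow
  have h0 : h ≠ 0 := by omega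
  have h3 : ¬ h < 2^d := by omega
  rw [semi_rd hy s d h (by omega) h2 (by omega)]
  simp only [step, lt_irrefl, h0, h3, if_false, dec_enc]
  by_cases d0 : d = 0
  · subst d0; simp
  · have := semi_leaf hy s h h1 h2 (d-1) (by omega)
    simp only [Bool.and_eq_true, Bool.or_eq_true, decide_eq_true_eq, this, d0, false_or]
    constructor
    · rintro ⟨a, b⟩
      exact ⟨a, fun i hi => b i (by omega)⟩
    · rintro ⟨a, b⟩
      exact ⟨a, fun i hi => b i (by omega)⟩

theorem semi_or {d : ℕ} {T : Bool → ℕ → Bool} {y : V d → Fin 3} (hy : Semi d T y)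
    (s : Bool) (h : ℕ) (h0 : h ≠ 0) (hh : h < 2^d) :
    rd y s d h = (rd y s d (2*h) || rd y s d (2*h+1)) := by
  rw [semi_rd hy s d h (by omega) (by rw [pow_succ]; omega) (by omega)]
  simp only [step, lt_irrefl, h0, hh, if_true, if_false, dec_enc]

theorem semi_find {d : ℕ} {T : Bool → ℕ → Bool} {y : V d → Fin 3} (hy : Semi d T y)
    (s : Bool) (m : ℕ) : ∀ h, h ≠ 0 → h < 2^(d+1) → 2^(d+1) - h ≤ m → rd y s d h = true →
      ∃ h', 2^d ≤ h' ∧ h' < 2^(d+1) ∧ rd y s d h' = true := by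
  induction m with
  | zero => intro h _ _ _; omega
  | succ m ih =>
    intro h h0 h1 h2 h3
    by_cases hh : h < 2^d
    · rw [semi_or hy s h h0 hh, Bool.or_eq_true] at h3
      rw [pow_succ] at *
      rcases h3 with h3 | h3
      · exact ih (2*h) (by omega) (by omega) (by omega) h3
      · exact ih (2*h+1) (by omega) (by omega) (by omega) h3
    · exact ⟨h, by omega, h1, h3⟩

theorem semi_up {d : ℕ} {T : Bool → ℕ → Bool} {y : V d → Fin 3} (hy : Semi d T y)
    (s : Bool) (h : ℕ) : h ≠ 0 → h < 2^(d+1) → rd y s d h = true → rd y s d 1 = true := by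
  induction h using Nat.strong_induction_on with
  | _ h ih =>
    intro h0 h1 h3
    by_cases hh : h = 1
    · rw [hh] at h3; exact h3
    · refine ih (h/2) (by omega) (by omega) (by omega) ?_
      rw [semi_or hy s (h/2) (by omega) (by rw [pow_succ] at h1; omega), Bool.or_eq_true]
      have : h = 2*(h/2) ∨ h = 2*(h/2)+1 := by omega
      rcases this with e | e
      · left; rw [← e]; exact h3
      · right; rw [← e]; exact h3

theorem semi_A {d : ℕ} {T : Bool → ℕ → Bool} {y : V d → Fin 3} (hy : Semi d T y) :
    rd y false d 0 = rd y false d 1 := by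
  rw [semi_rd hy false d 0 (by omega) (by positivity) (by simp)]
  simp [step, dec_enc]

theorem leaf_ext {d h h' : ℕ} (h1 : 2^d ≤ h) (h2 : h < 2^(d+1)) (h1' : 2^d ≤ h') (h2' : h' < 2^(d+1))
    (H : ∀ i < d, h.testBit i = h'.testBit i) : h = h' := by
  have h3 : h % 2^d = h' % 2^d := by
    apply Nat.eq_of_testBit_eq
    intro i
    rw [Nat.testBit_mod_two_pow, Nat.testBit_mod_two_pow]
    by_cases hi : i < d
    · rw [H i hi]
    · simp [hi]
  rw [pow_succ] at h2 h2'
  rw [Nat.mod_eq_sub_mod h1, Nat.mod_eq_sub_mod h1', Nat.mod_eq_of_lt (by omega), Nat.mod_eq_of_lt (by omega)] at h3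
  omega

def out (d : ℕ) : V d := (true, ⟨d, by omega⟩, ⟨0, by positivity⟩)

theorem isOut_iff (d : ℕ) (v : V d) : IsOut d v ↔ v = out d := by
  obtain ⟨s, ⟨j, hj⟩, ⟨h, hh⟩⟩ := v
  simp [IsOut, out]

theorem F_out (d : ℕ) (T : Bool → ℕ → Bool) (y : V d → Fin 3) :
    F d T y (out d) = enc (rd y true d 1 && rd y false d 0 && !rd y true d 0) := by
  simp [F, step, out]

theorem yes_out {d : ℕ} {T : Bool → ℕ → Bool}
    (hT : ∀ h, 2^d ≤ h → h < 2^(d+1) → ¬ (T false h = true ∧ T true h = true))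
    {y : V d → Fin 3} (hy : Semi d T y) : F d T y (out d) = 0 := by
  have hp : 1 < 2^(d+1) := Nat.one_lt_two_pow (by omega)
  rw [F_out]
  by_cases hA : rd y false d 0 = true
  · by_cases hB : rd y true d 1 = true
    · exfalso
      rw [semi_A hy] at hA
      obtain ⟨a, a1, a2, a3⟩ := semi_find hy false _ 1 (by omega) hp le_rfl hA
      obtain ⟨b, b1, b2, b3⟩ := semi_find hy true _ 1 (by omega) hp le_rfl hB
      rw [semi_top hy _ _ a1 a2] at a3
      rw [semi_top hy _ _ b1 b2] at b3
      have : a = b := leaf_ext a1 a2 b1 b2 fun i hi => by rw [← a3.2 i hi, ← b3.2 i hi]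
      subst this
      exact hT a a1 a2 ⟨a3.1, b3.1⟩
    · simp [hB, enc]
  · simp [hA, enc]

theorem yes_conv {d : ℕ} {T : Bool → ℕ → Bool}
    (hT : ∀ h, 2^d ≤ h → h < 2^(d+1) → ¬ (T false h = true ∧ T true h = true))
    (k : ℕ) (hk : 3*d+4 ≤ k) : ConvergesIn (F d T) k := by
  intro x
  have hs : ∀ t, 3*d+3 ≤ t → Semi d T ((F d T)^[t] x) := fun t ht v hv =>
    settle d T x t v hv ((rank_le _ _ _ _).trans ht)
  funext v
  by_cases hv : IsOut d v
  · rw [isOut_iff] at hv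
    subst hv
    rw [yes_out hT (hs k (by omega))]
    obtain ⟨k', rfl⟩ : ∃ k', k = k' + 1 := ⟨k-1, by omega⟩
    rw [Function.iterate_succ_apply', yes_out hT (hs k' (by omega))]
  · exact hs k (by omega) v hv

theorem no_conv {d : ℕ} {T : Bool → ℕ → Bool} {h : ℕ} (h1 : 2^d ≤ h) (h2 : h < 2^(d+1))
    (hA : T false h = true) (hB : T true h = true) (k : ℕ) : ¬ ConvergesIn (F d T) k := by
  intro H
  have hp : 1 < 2^(d+1) := Nat.one_lt_two_pow (by omega)
  have hp' : (2:ℕ)^d ≥ 1 := Nat.one_le_two_pow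
  let x : V d → Fin 3 := fun v => enc (h.testBit v.2.1)
  have inp : ∀ t i, ∀ hi : i < d, (F d T)^[t] x (false, ⟨i, by omega⟩, ⟨0, by positivity⟩) = enc (h.testBit i) := by
    intro t i hi
    induction t with
    | zero => rfl
    | succ t ih =>
      rw [Function.iterate_succ_apply', ← ih]
      simp [F, step, hi]
  have hx := H x
  set y := (F d T)^[k] x with hy
  have hs : Semi d T y := fun v _ => by rw [hx]
  have bits : ∀ i < d, rd y false i 0 = h.testBit i := by
    intro i hi
    unfold rd
    rw [dif_pos ⟨by omega, by positivity⟩, hy, inp k i hi, dec_enc]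
  have r : ∀ s, rd y s d 1 = true := by
    intro s
    apply semi_up hs s h (by omega) h2
    rw [semi_top hs s h h1 h2]
    refine ⟨?_, bits⟩
    cases s
    · exact hA
    · exact hB
  have ho : F d T y (out d) = y (out d) := by rw [hx]
  rw [F_out, semi_A hs, r, r] at ho
  have e : rd y true d 0 = dec (y (out d)) := by
    unfold rd
    rw [dif_pos ⟨by omega, by positivity⟩]; rfl
  rw [← ho, dec_enc] at e
  revert e
  cases rd y true d 0 <;> simp

/-! Fooling set -/

def tab {d : ℕ} (f : Fin (2^d) → Bool) (h : ℕ) : Bool :=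
  if hh : h - 2^d < 2^d then f ⟨h - 2^d, hh⟩ else false

def TT {d : ℕ} (f g : Fin (2^d) → Bool) (s : Bool) (h : ℕ) : Bool :=
  if s then !(tab g h) else tab f h

theorem cert_card (s : ℕ) (B : Type) [Fintype B] (α : Type) [Fintype α]
    (φ : α → B → List Bool) (hlen : ∀ a b, (φ a b).length ≤ s)
    (hinj : Function.Injective φ) : Fintype.card α ≤ (2^(2*s))^(Fintype.card B) := by
  classical
  let ψ : α → B → (Fin (s+1) × (Fin s → Bool)) := fun a b =>
    (⟨(φ a b).length, by have := hlen a b; omega⟩, fun i => (φ a b).getD i false)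
  have hψ : Function.Injective ψ := by
    intro a a' e
    apply hinj
    funext b
    have e1 := congrFun e b
    simp only [ψ, Prod.mk.injEq, Fin.mk.injEq] at e1
    apply List.ext_getElem e1.1
    intro i h1 h2
    have := congrFun e1.2 ⟨i, lt_of_lt_of_le h1 (hlen a b)⟩
    simpa [List.getD_eq_getElem, h1, h2] using this
  have := Fintype.card_le_of_injective ψ hψ
  refine this.trans ?_
  classical
  rw [Fintype.card_fun]
  apply Nat.pow_le_pow_left
  simp only [Fintype.card_prod, Fintype.card_fin, Fintype.card_fun, Fintype.card_bool]
  rw [two_mul, pow_add]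
  exact Nat.mul_le_mul_right _ (Nat.lt_two_pow_self)

theorem main (d k s n : ℕ) (hn : Fintype.card (V d) = n) (hk : 3*d+4 ≤ k) (π : PLS n (Fin 3))
    (hπ : π.Correct (fun G _ => ∀ v, (G.neighborSet v).ncard ≤ 3)
            (fun _ F => ConvergesIn F k) (fun _ _ => s) (n * n)) :
    2^d ≤ 4 * s * (d+1) := by
  classical
  let e : V d ≃ Fin n := Fintype.equivFinOfCardEq hn
  let G : SimpleGraph (Fin n) := (Gr d).comap e.symm
  let Φ : (Bool → ℕ → Bool) → (Fin n → Fin 3) → Fin n → Fin 3 :=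
    fun T x v => F d T (x ∘ e) (e.symm v)
  let ids : Fin n → ℕ := fun v => v + 1
  have hG : G.Connected := ((SimpleGraph.Iso.comap e.symm (Gr d)).connected_iff).2 (conn d)
  have hF : ∀ T, IsFSD G (Φ T) := by
    intro T v x y H
    apply fsd d T
    intro w hw
    apply H
    rcases hw with hw | hw
    · left; simp [hw]
    · right
      simpa [G, SimpleGraph.mem_neighborSet] using hw
  have hD : ∀ v, (G.neighborSet v).ncard ≤ 3 := by
    intro v
    rw [← Set.ncard_image_of_injective _ e.symm.injective]
    refine (Set.ncard_le_ncard ?_ (Set.toFinite _)).trans (deg d (e.symm v))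
    rintro _ ⟨w, hw, rfl⟩
    exact hw
  have hids : Function.Injective ids := by
    intro a b hab; simp [ids] at hab; exact Fin.ext hab
  have hids2 : ∀ v, 1 ≤ ids v ∧ ids v ≤ n * n := by
    intro v
    have := v.2
    refine ⟨by simp [ids], ?_⟩
    calc ids v ≤ n := this
      _ ≤ n * n := Nat.le_mul_self n
  have iter : ∀ T t x, ((Φ T)^[t] x) ∘ e = (F d T)^[t] (x ∘ e) := by
    intro T t x
    induction t with
    | zero => rfl
    | succ t ih =>
      rw [Function.iterate_succ_apply', Function.iterate_succ_apply', ← ih]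
      funext v
      simp [Φ]
  have hconv : ∀ T, ConvergesIn (Φ T) k ↔ ConvergesIn (F d T) k := by
    intro T
    constructor
    · intro H x
      have h1 := H (x ∘ e.symm)
      have h2 := iter T k (x ∘ e.symm)
      have h3 : (x ∘ e.symm) ∘ e = x := by funext v; simp
      rw [h3] at h2
      rw [← h2]
      funext v
      have := congrFun h1 (e v)
      simpa [Φ] using this
    · intro H x
      funext v
      have h1 := congrFun (H (x ∘ e)) (e.symm v)
      rw [← iter] at h1
      simpa [Φ] using h1
  have hyes : ∀ f : Fin (2^d) → Bool, ∃ cert : Fin n → List Bool, (∀ v, (cert v).length ≤ s) ∧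
      ∀ v, π.verify G (Φ (TT f f)) ids cert v = true := by
    intro f
    refine (hπ G (Φ (TT f f)) hG (hF _) hD ids hids hids2).1 ((hconv _).2 (yes_conv ?_ k hk))
    intro h _ _
    simp [TT]
  choose cert hc1 hc2 using hyes
  let φ : (Fin (2^d) → Bool) → (Bool × Fin (d+1)) → List Bool :=
    fun f b => cert f (e (b.1, b.2, ⟨0, by positivity⟩))
  have main1 : ∀ f g i, φ f = φ g → f i = true → g i = false → False := by
    intro f g i hfg hf hg
    have hi : (2^d + i.1) - 2^d < 2^d := by have := i.2; omega
    have hno : ¬ ConvergesIn (Φ (TT f g)) k := by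
      rw [hconv]
      have := i.2
      apply no_conv (h := 2^d + i.1) (by omega) (by rw [pow_succ]; omega)
      · simp [TT, tab, hf]
      · simp [TT, tab, hg]
    let cc : Fin n → List Bool := fun v => if (e.symm v).1 then cert g v else cert f v
    obtain ⟨v, hv⟩ := (hπ G (Φ (TT f g)) hG (hF _) hD ids hids hids2).2 hno cc (by
      intro v; simp only [cc]; split_ifs
      · exact hc1 g v
      · exact hc1 f v)
    have cross : ∀ w, G.Adj v w → (e.symm v).1 ≠ (e.symm w).1 → cert f w = cert g w := by
      intro w hw hne
      have hw' : (Gr d).Adj (e.symm v) (e.symm w) := hw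
      rw [Gr, SimpleGraph.fromRel_adj] at hw'
      have h0 : ((e.symm w).2.2 : ℕ) = 0 := by
        rcases hw'.2 with (h | h | h) | (h | h | h)
        · exact absurd h.1 hne
        · exact absurd h.1 hne
        · exact h.2.2.2
        · exact absurd h.1.symm hne
        · exact absurd h.1.symm hne
        · exact h.2.2.1
      have := congrFun hfg ((e.symm w).1, (e.symm w).2.1)
      have ew : e ((e.symm w).1, (e.symm w).2.1, ⟨0, by positivity⟩) = w := by
        rw [← e.apply_symm_apply w]
        congr 1
        simp only [e.symm_apply_apply]
        exact Prod.ext rfl (Prod.ext rfl (Fin.ext h0.symm))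
      simpa only [φ, ew] using this
    have contra : ∀ p : Fin (2^d) → Bool, (∀ x, Φ (TT f g) x v = Φ (TT p p) x v) → cc v = cert p v →
        (∀ w, G.Adj v w → cc w = cert p w) → False := by
      intro p h1 h2 h3
      have := π.locality G G (Φ (TT f g)) (Φ (TT p p)) ids ids cc (cert p) v (fun _ => Iff.rfl) rfl
        (fun _ _ => rfl) h1 h2 h3
      rw [hv, hc2] at this
      exact absurd this (by simp)
    cases hs : (e.symm v).1
    · apply contra f
      · intro x; simp only [Φ, F, hs]; rfl
      · simp [cc, hs]
      · intro w hw
        cases hsw : (e.symm w).1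
        · simp [cc, hsw]
        · simp only [cc, hsw, if_true]
          exact (cross w hw (by rw [hs, hsw]; simp)).symm
    · apply contra g
      · intro x; simp only [Φ, F, hs]; rfl
      · simp [cc, hs]
      · intro w hw
        cases hsw : (e.symm w).1
        · simp only [cc, hsw]
          exact (cross w hw (by rw [hs, hsw]; simp))
        · simp [cc, hsw]
  have hinj : Function.Injective φ := by
    intro f g hfg
    funext i
    cases hf : f i <;> cases hg : g i
    · rfl
    · exact (main1 g f i hfg.symm hg hf).elim
    · exact (main1 f g i hfg hf hg).elim
    · rfl
  have := cert_card s _ _ φ (fun f b => hc1 f _) hinj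
  simp only [Fintype.card_fun, Fintype.card_bool, Fintype.card_fin, Fintype.card_prod] at this
  rw [← pow_mul] at this
  have := (Nat.pow_le_pow_iff_right (by norm_num)).1 this
  calc 2^d ≤ _ := this
    _ = 4 * s * (d+1) := by ring

theorem card_V (d : ℕ) : Fintype.card (V d) = (d+1) * 2^(d+2) := by
  simp only [V, Fintype.card_prod, Fintype.card_bool, Fintype.card_fin]
  ring

end St5

/-!
STATEMENT 5: There exist a function k(n) = Θ(log n) and a constant c > 0 such that
for infinitely many n, every proof-labeling scheme for Convergence(k(n),3), even
when the problem is restricted to input graphs of maximum degree at most 3, requires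
certificates of size at least c · n / (log n)² bits.
-/
theorem statement_5 :
    ∃ (k : ℕ → ℕ) (a b c : ℝ), 0 < a ∧ 0 < b ∧ 0 < c ∧
      (∀ᶠ n : ℕ in Filter.atTop,
        a * Real.log n ≤ (k n : ℝ) ∧ (k n : ℝ) ≤ b * Real.log n) ∧
      {n : ℕ | ∀ (s : ℕ) (π : PLS n (Fin 3)),
          π.Correct (fun G _ => ∀ v, (G.neighborSet v).ncard ≤ 3)
            (fun _ F => ConvergesIn F (k n))
            (fun _ _ => s) (n * n) →
          c * (n : ℝ) / (Real.log n) ^ 2 ≤ (s : ℝ)}.Infinite := by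
  refine ⟨fun n => 8 * Nat.log 2 n, 1, 16, 1/64, by norm_num, by norm_num, by norm_num, ?_, ?_⟩
  · filter_upwards [Filter.eventually_ge_atTop 2] with n hn
    have l1 : (0.6931471803:ℝ) < Real.log 2 := Real.log_two_gt_d9
    have l2 : Real.log 2 < (0.6931471808:ℝ) := Real.log_two_lt_d9
    have hL : 1 ≤ Nat.log 2 n := Nat.log_pos (by norm_num) hn
    have hL' : (1:ℝ) ≤ (Nat.log 2 n : ℝ) := by exact_mod_cast hL
    have hn0 : (0:ℝ) < n := by exact_mod_cast (by omega : 0 < n)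
    have u1 : (2:ℝ) ^ (Nat.log 2 n) ≤ n := by exact_mod_cast Nat.pow_log_le_self 2 (by omega)
    have u2 : (n:ℝ) ≤ (2:ℝ) ^ (Nat.log 2 n + 1) := by
      exact_mod_cast (Nat.lt_pow_succ_log_self (by norm_num : 1 < 2) n).le
    have v1 := Real.log_le_log (by positivity) u1
    have v2 := Real.log_le_log hn0 u2
    rw [Real.log_pow] at v1 v2
    push_cast at v1 v2 ⊢
    constructor <;> nlinarith
  · have hinf : (Set.range fun d : ℕ => (d+1) * 2^(d+2)).Infinite := by
      apply Set.infinite_range_of_injective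
      apply StrictMono.injective
      apply strictMono_nat_of_lt_succ
      intro d
      have : 2^(d+1+2) = 2 * 2^(d+2) := by ring
      rw [this]
      have : 0 < 2^(d+2) := by positivity
      nlinarith
    refine hinf.mono ?_
    rintro _ ⟨d, rfl⟩ s π hπ
    have hlog : d + 2 ≤ Nat.log 2 ((d+1) * 2^(d+2)) := by
      apply Nat.le_log_of_pow_le (by norm_num)
      exact Nat.le_mul_of_pos_left _ (by omega)
    have hmain := St5.main d _ s _ (St5.card_V d) (by show 3*d+4 ≤ 8 * Nat.log 2 ((d+1) * 2^(d+2)); omega) π hπ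
    have hmain' : (2:ℝ)^d ≤ 4 * s * (d+1) := by exact_mod_cast hmain
    have l1 : (0.6931471803:ℝ) < Real.log 2 := Real.log_two_gt_d9
    have hl : ((d:ℝ)+1)/2 ≤ Real.log (((d+1) * 2^(d+2) : ℕ) : ℝ) := by
      have : (2:ℝ)^(d+2) ≤ (((d+1) * 2^(d+2) : ℕ) : ℝ) := by
        exact_mod_cast Nat.le_mul_of_pos_left _ (by omega)
      have := Real.log_le_log (by positivity) this
      rw [Real.log_pow] at this
      push_cast at this ⊢
      have hd : (0:ℝ) ≤ d := by positivity
      nlinarith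
    have hd : (0:ℝ) < (d:ℝ)+1 := by positivity
    have hsq : (((d:ℝ)+1)/2)^2 ≤ Real.log (((d+1) * 2^(d+2) : ℕ) : ℝ) ^ 2 :=
      pow_le_pow_left₀ (by positivity) hl 2
    rw [div_le_iff₀ (lt_of_lt_of_le (by positivity) hsq)]
    refine le_trans ?_ (mul_le_mul_of_nonneg_left hsq (by positivity))
    push_cast
    rw [pow_add]
    nlinarith [mul_le_mul_of_nonneg_left hmain' hd.le]
end
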